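/- There exist constants C > 0 and D such that for every integer d ≥ D and every real ε > 0 there exists n₀ such that for every integer n ≥ n₀ the following holds: every finite set of points in ℝ² in general position of cardinality at least 2^{(1 + C/√d)·n/d + ε·n} contains a subset of n points that lies on a Jordan curve with stabbing number at most d. -/

import Mathlib

open Set

/-- Points of the plane. -/
abbrev Pt := ℝ × ℝ

/-- An affine line in ℝ², given by a nontrivial linear equation. -/
def IsAffLine (l : Set Pt) : Prop :=
  ∃ a b c : ℝ, (a ≠ 0 ∨ b ≠ 0) ∧ l = {p : Pt | a * p.1 + b * p.2 = c}

/-- An open half-plane in ℝ². -/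
def IsOpenHalfPlane (H : Set Pt) : Prop :=
  ∃ a b c : ℝ, (a ≠ 0 ∨ b ≠ 0) ∧ H = {p : Pt | a * p.1 + b * p.2 < c}

/-- `A` and `B` are linearly separable: some affine line has `A` strictly on
one side and `B` strictly on the other side. -/
def LinSep (A B : Set Pt) : Prop :=
  ∃ a b c : ℝ, (a ≠ 0 ∨ b ≠ 0) ∧ (∀ p ∈ A, a * p.1 + b * p.2 < c) ∧
    (∀ p ∈ B, c < a * p.1 + b * p.2)

/-- General position: no three (distinct) points of `X` are collinear. -/
def GenPos (X : Set Pt) : Prop :=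
  ∀ p ∈ X, ∀ q ∈ X, ∀ r ∈ X, p ≠ q → p ≠ r → q ≠ r →
    ¬ Collinear ℝ ({p, q, r} : Set Pt)

/-- Convex position: no point of `X` lies in the convex hull of the others. -/
def ConvexPos (X : Set Pt) : Prop :=
  ∀ p ∈ X, p ∉ convexHull ℝ (X \ {p})

/-- A cell of an arrangement `L` of lines: a connected component of the
complement of the union of the lines. -/
def IsCell (L : Set (Set Pt)) (cell : Set Pt) : Prop :=
  ∃ p ∈ (⋃₀ L)ᶜ, cell = connectedComponentIn (⋃₀ L)ᶜ p

/-- `S` has at most `d` connected components: among any `d + 1` points of `S`,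
two lie in the same connected component of `S`. -/
def CompsLE (S : Set Pt) (d : ℕ) : Prop :=
  ∀ f : Fin (d + 1) → Pt, (∀ i, f i ∈ S) →
    ∃ i j, i ≠ j ∧ connectedComponentIn S (f i) = connectedComponentIn S (f j)

/-- A Jordan curve: the image of a continuous injective map from the unit
circle to the plane. -/
def IsJordanCurve (J : Set Pt) : Prop :=
  ∃ f : EuclideanSpace ℝ (Fin 2) → Pt,
    ContinuousOn f (Metric.sphere 0 1) ∧ Set.InjOn f (Metric.sphere 0 1) ∧
      J = f '' (Metric.sphere 0 1)

/-- `J` has stabbing number at most `d` (a natural number): every affine line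
meets `J` in at most `d` connected components. -/
def StabLE (J : Set Pt) (d : ℕ) : Prop :=
  ∀ l, IsAffLine l → CompsLE (J ∩ l) d

/-- `J` has stabbing number at most a real number `d`: every affine line meets
`J` in at most `⌊d⌋₊` connected components. -/
def StabLER (J : Set Pt) (d : ℝ) : Prop :=
  ∀ l, IsAffLine l → CompsLE (J ∩ l) ⌊d⌋₊


def IsC {α : Type*} [LinearOrder α] (R : α → α → α → Prop) (T : Finset α) : Prop :=
  ∀ a ∈ T, ∀ b ∈ T, ∀ c ∈ T, a < b → b < c → R a b c

def Trans3 {α : Type*} [LinearOrder α] (R : α → α → α → Prop) : Prop :=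
  ∀ a b c d, a < b → b < c → c < d → R a b c → R b c d → R a b d ∧ R a c d

theorem isC_small {α : Type*} [LinearOrder α] (R : α → α → α → Prop) (T : Finset α)
    (h : T.card ≤ 2) : IsC R T := by
  intro a ha b hb c hc hab hbc
  exfalso
  have : ({a, b, c} : Finset α).card ≤ T.card := by
    apply Finset.card_le_card
    intro x hx
    simp only [Finset.mem_insert, Finset.mem_singleton] at hx
    rcases hx with rfl | rfl | rfl <;> assumption
  rw [Finset.card_eq_three.mpr ⟨a, b, c, hab.ne, (hab.trans hbc).ne, hbc.ne, rfl⟩] at this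
  omega

theorem isC_insert_right {α : Type*} [LinearOrder α] {R : α → α → α → Prop} (hR : Trans3 R)
    (T : Finset α) (hT : IsC R T) (p q r : α) (hp : p ∈ T) (hq : q ∈ T) (hpq : p < q) (hqr : q < r)
    (hmax : ∀ x ∈ T, x = q ∨ x ≤ p) (h : R p q r) : IsC R (insert r T) := by
  have hle : ∀ x ∈ T, x ≤ q := fun x hx => by
    rcases hmax x hx with h | h
    · exact h.le
    · exact h.trans hpq.le
  have key1 : ∀ a ∈ T, a < p → R a p r ∧ R a q r := fun a ha hap =>
    hR a p q r hap hpq hqr (hT a ha p hp q hq hap hpq) h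
  have key2 : ∀ a ∈ T, ∀ b ∈ T, a < b → R a b r := by
    intro a ha b hb hab
    rcases hmax b hb with rfl | hbp
    · rcases hmax a ha with rfl | hap
      · exact absurd hab (lt_irrefl _)
      · rcases hap.eq_or_lt with rfl | hap
        · exact h
        · exact (key1 a ha hap).2
    · rcases hbp.eq_or_lt with rfl | hbp
      · exact (key1 a ha hab).1
      · exact (hR a b p r hab hbp (hpq.trans hqr) (hT a ha b hb p hp hab hbp) (key1 b hb hbp).1).1
  intro a ha b hb c hc hab hbc
  rw [Finset.mem_insert] at ha hb hc
  have hlt : ∀ x ∈ T, x < r := fun x hx => (hle x hx).trans_lt hqr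
  rcases hc with rfl | hc
  · rcases hb with rfl | hb
    · exact absurd hbc (lt_irrefl _)
    · rcases ha with rfl | ha
      · exact absurd (hab.trans hbc) (lt_irrefl _)
      · exact key2 a ha b hb hab
  · rcases hb with rfl | hb
    · exact absurd hbc (hlt c hc).asymm
    · rcases ha with rfl | ha
      · exact absurd hab (hlt b hb).asymm
      · exact hT a ha b hb c hc hab hbc

theorem isC_insert_left {α : Type*} [LinearOrder α] {R : α → α → α → Prop} (hR : Trans3 R)
    (T : Finset α) (hT : IsC R T) (p q r : α) (hr : r ∈ T) (hq : q ∈ T) (hpq : p < q) (hqr : q < r)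
    (hmin : ∀ x ∈ T, x = q ∨ r ≤ x) (h : R p q r) : IsC R (insert p T) := by
  have := isC_insert_right (α := αᵒᵈ) (R := fun a b c => R (OrderDual.ofDual c) (OrderDual.ofDual b) (OrderDual.ofDual a))
    (by
      intro a b c d hab hbc hcd h1 h2
      exact (hR _ _ _ _ hcd hbc hab h2 h1).symm)
    (T : Finset α) (fun a ha b hb c hc hab hbc => hT _ hc _ hb _ ha hbc hab)
    r q p hr hq hqr hpq hmin h
  intro a ha b hb c hc hab hbc
  exact this c hc b hb a ha hbc hab

theorem es {α : Type*} [LinearOrder α] (R : α → α → α → Prop) (h1 : Trans3 R)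
    (h2 : Trans3 (fun a b c => ¬ R a b c)) : ∀ (k l : ℕ) (S : Finset α), 2 ^ (k + l) ≤ S.card →
      (∃ T ⊆ S, T.card = k ∧ IsC R T) ∨ (∃ T ⊆ S, T.card = l ∧ IsC (fun a b c => ¬ R a b c) T) := by
  intro k
  induction k with
  | zero => intro l S _; exact Or.inl ⟨∅, by simp, by simp, by simp [IsC]⟩
  | succ k ihk =>
    intro l
    induction l with
    | zero => intro S _; exact Or.inr ⟨∅, by simp, by simp, by simp [IsC]⟩
    | succ l ihl =>
      intro S hS
      have hb1 : k + 1 ≤ 2 ^ (k + 1 + (l + 1)) :=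
        (Nat.lt_two_pow_self (n := k+1)).le.trans (Nat.pow_le_pow_right (by norm_num) (by omega))
      have hb2 : l + 1 ≤ 2 ^ (k + 1 + (l + 1)) :=
        (Nat.lt_two_pow_self (n := l+1)).le.trans (Nat.pow_le_pow_right (by norm_num) (by omega))
      by_cases hk : k + 1 ≤ 2
      · obtain ⟨T, hT, hc⟩ := Finset.exists_subset_card_eq (hb1.trans hS)
        exact Or.inl ⟨T, hT, hc, isC_small _ _ (by omega)⟩
      by_cases hl : l + 1 ≤ 2
      · obtain ⟨T, hT, hc⟩ := Finset.exists_subset_card_eq (hb2.trans hS)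
        exact Or.inr ⟨T, hT, hc, isC_small _ _ (by omega)⟩
      classical
      set Q := S.filter (fun q => ∃ T ⊆ S, T.card = k ∧ IsC R T ∧ q ∈ T ∧ ∀ x ∈ T, x ≤ q) with hQ
      have hsplit : 2 ^ (k + (l + 1)) ≤ (S \ Q).card ∨ 2 ^ (k + 1 + l) ≤ Q.card := by
        have hQS : Q ⊆ S := Finset.filter_subset _ _
        have := Finset.card_sdiff_add_card_eq_card hQS
        have e1 : 2 ^ (k + 1 + (l + 1)) = 2 ^ (k + (l + 1)) + 2 ^ (k + 1 + l) := by ring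
        omega
      rcases hsplit with h | h
      · rcases ihk (l + 1) _ h with ⟨T, hTS, hTc, hT⟩ | ⟨T, hTS, hTc, hT⟩
        · exfalso
          have hne : T.Nonempty := by rw [← Finset.card_pos]; omega
          have hm := T.max'_mem hne
          have hm2 := hTS hm
          rw [Finset.mem_sdiff] at hm2
          apply hm2.2
          rw [hQ, Finset.mem_filter]
          exact ⟨hm2.1, T, hTS.trans Finset.sdiff_subset, hTc, hT, hm, fun x hx => T.le_max' x hx⟩
        · exact Or.inr ⟨T, hTS.trans Finset.sdiff_subset, hTc, hT⟩
      · rcases ihl _ h with ⟨T, hTS, hTc, hT⟩ | ⟨T', hTS', hTc', hT'⟩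
        · exact Or.inl ⟨T, hTS.trans (Finset.filter_subset _ _), hTc, hT⟩
        · have hne : T'.Nonempty := by rw [← Finset.card_pos]; omega
          set q := T'.min' hne with hq
          have hqT' : q ∈ T' := T'.min'_mem hne
          have hqm : ∀ x ∈ T', q ≤ x := fun x hx => T'.min'_le x hx
          have hqQ := hTS' hqT'
          rw [hQ, Finset.mem_filter] at hqQ
          obtain ⟨hqS, T, hTS, hTc, hT, hqT, hmax⟩ := hqQ
          have hne1 : (T.erase q).Nonempty := by
            rw [← Finset.card_pos, Finset.card_erase_of_mem hqT]; omega
          have hne2 : (T'.erase q).Nonempty := by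
            rw [← Finset.card_pos, Finset.card_erase_of_mem hqT']; omega
          obtain ⟨p, hp, hpm⟩ := (T.erase q).exists_max_image id hne1
          obtain ⟨r, hr, hrm⟩ := (T'.erase q).exists_min_image id hne2
          rw [Finset.mem_erase] at hp hr
          have hpq : p < q := lt_of_le_of_ne (hmax p hp.2) hp.1
          have hqr : q < r := lt_of_le_of_ne (hqm r hr.2) (Ne.symm hr.1)
          by_cases hR : R p q r
          · left
            refine ⟨insert r T, ?_, ?_, isC_insert_right h1 T hT p q r hp.2 hqT hpq hqr ?_ hR⟩
            · exact Finset.insert_subset (Finset.filter_subset _ _ (hTS' hr.2)) hTS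
            · rw [Finset.card_insert_of_notMem, hTc]
              intro hrT; exact absurd (hmax r hrT) (not_le.mpr hqr)
            · intro x hx
              by_cases hxq : x = q
              · exact Or.inl hxq
              · exact Or.inr (hpm x (Finset.mem_erase.mpr ⟨hxq, hx⟩))
          · right
            refine ⟨insert p T', ?_, ?_, isC_insert_left h2 T' hT' p q r hr.2 hqT' hpq hqr ?_ hR⟩
            · exact Finset.insert_subset (hTS hp.2) (hTS'.trans (Finset.filter_subset _ _))
            · rw [Finset.card_insert_of_notMem, hTc']
              intro hrT; exact absurd (hqm p hrT) (not_le.mpr hpq)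
            · intro x hx
              by_cases hxq : x = q
              · exact Or.inl hxq
              · exact Or.inr (hrm x (Finset.mem_erase.mpr ⟨hxq, hx⟩))

/-- Orientation determinant. -/
def ori (p q r : Pt) : ℝ := (q.1 - p.1) * (r.2 - p.2) - (q.2 - p.2) * (r.1 - p.1)

theorem ori_ne_zero {X : Set Pt} (hX : GenPos X) {p q r : Pt} (hp : p ∈ X) (hq : q ∈ X) (hr : r ∈ X)
    (hpq : p ≠ q) (hpr : p ≠ r) (hqr : q ≠ r) : ori p q r ≠ 0 := by
  intro h
  apply hX p hp q hq r hr hpq hpr hqr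
  rw [collinear_iff_of_mem (p₀ := p) (by simp)]
  refine ⟨q - p, ?_⟩
  intro z hz
  simp only [Set.mem_insert_iff, Set.mem_singleton_iff] at hz
  rcases hz with rfl | rfl | rfl
  · exact ⟨0, by simp⟩
  · exact ⟨1, by simp⟩
  · unfold ori at h
    by_cases h1 : q.1 - p.1 = 0
    · have h2 : q.2 - p.2 ≠ 0 := by
        intro h2
        apply hpq
        ext <;> linarith
      refine ⟨(z.2 - p.2) / (q.2 - p.2), ?_⟩
      ext
      · simp only [vadd_eq_add, Prod.fst_add, Prod.smul_fst, Prod.fst_sub, smul_eq_mul]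
        rw [h1] at h ⊢
        have : z.1 - p.1 = 0 := by
          rcases mul_eq_zero.mp (by linarith : (q.2 - p.2) * (z.1 - p.1) = 0) with h | h
          · exact absurd h h2
          · exact h
        linarith
      · simp only [vadd_eq_add, Prod.snd_add, Prod.smul_snd, Prod.snd_sub, smul_eq_mul]
        field_simp
        ring
    · refine ⟨(z.1 - p.1) / (q.1 - p.1), ?_⟩
      ext
      · simp only [vadd_eq_add, Prod.fst_add, Prod.smul_fst, Prod.fst_sub, smul_eq_mul]
        field_simp
        ring
      · simp only [vadd_eq_add, Prod.snd_add, Prod.smul_snd, Prod.snd_sub, smul_eq_mul]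
        field_simp
        linarith

theorem trans3_pos {α : Type*} [LinearOrder α] (p : α → Pt) (hp : StrictMono (fun a => (p a).1)) :
    Trans3 (fun a b c => 0 < ori (p a) (p b) (p c)) := by
  intro a b c d hab hbc hcd h1 h2
  have e1 := hp hab
  have e2 := hp hbc
  have e3 := hp hcd
  simp only [ori] at *
  generalize p a = A at *
  generalize p b = B at *
  generalize p c = C at *
  generalize p d = E at *
  constructor
  · have : 0 < (C.1 - B.1) * ((B.1 - A.1) * (E.2 - A.2) - (B.2 - A.2) * (E.1 - A.1)) := by
      nlinarith [mul_pos (sub_pos.2 e1) h2, mul_pos (sub_pos.2 (e2.trans e3)) h1]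
    exact pos_of_mul_pos_right this (sub_pos.2 e2).le
  · have : 0 < (C.1 - B.1) * ((C.1 - A.1) * (E.2 - A.2) - (C.2 - A.2) * (E.1 - A.1)) := by
      nlinarith [mul_pos (sub_pos.2 (e1.trans e2)) h2, mul_pos (sub_pos.2 e3) h1]
    exact pos_of_mul_pos_right this (sub_pos.2 e2).le

theorem trans3_neg {α : Type*} [LinearOrder α] (p : α → Pt) (hp : StrictMono (fun a => (p a).1)) :
    Trans3 (fun a b c => ¬ 0 < ori (p a) (p b) (p c)) := by
  intro a b c d hab hbc hcd h1 h2
  have e1 := hp hab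
  have e2 := hp hbc
  have e3 := hp hcd
  simp only [ori, not_lt] at *
  generalize p a = A at *
  generalize p b = B at *
  generalize p c = C at *
  generalize p d = E at *
  constructor
  · have : (C.1 - B.1) * ((B.1 - A.1) * (E.2 - A.2) - (B.2 - A.2) * (E.1 - A.1)) ≤ 0 := by
      nlinarith [mul_nonneg (sub_pos.2 e1).le (neg_nonneg.2 h2), mul_nonneg (sub_pos.2 (e2.trans e3)).le (neg_nonneg.2 h1)]
    exact nonpos_of_mul_nonpos_right this (sub_pos.2 e2)
  · have : (C.1 - B.1) * ((C.1 - A.1) * (E.2 - A.2) - (C.2 - A.2) * (E.1 - A.1)) ≤ 0 := by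
      nlinarith [mul_nonneg (sub_pos.2 (e1.trans e2)).le (neg_nonneg.2 h2), mul_nonneg (sub_pos.2 e3).le (neg_nonneg.2 h1)]
    exact nonpos_of_mul_nonpos_right this (sub_pos.2 e2)

theorem exists_median {α : Type*} [DecidableEq α] (s : Finset α) (k : ℕ) (hk : 0 < k) (hs : 2 * k ≤ s.card)
    (f : ℝ → α → ℝ) (hf : ∀ a, Continuous (fun u => f u a)) :
    ∃ M : ℝ → ℝ, Continuous M ∧ ∀ u, k ≤ (s.filter (fun a => f u a ≤ M u)).card ∧
      k ≤ (s.filter (fun a => M u ≤ f u a)).card := by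
  classical
  have : Nonempty (Fin k) := ⟨⟨0, hk⟩⟩
  have : Nonempty (Fin k ↪ s) :=
    Function.Embedding.nonempty_of_card_le (by simp; omega)
  refine ⟨fun u => Finset.univ.inf' Finset.univ_nonempty (fun e : Fin k ↪ s =>
    Finset.univ.sup' Finset.univ_nonempty (fun i : Fin k => f u (e i))), ?_, ?_⟩
  · refine Continuous.finset_inf'_apply (f := fun (e : Fin k ↪ s) u => Finset.univ.sup' Finset.univ_nonempty (fun i : Fin k => f u (e i))) _ ?_
    intro e _
    exact Continuous.finset_sup'_apply (f := fun (i : Fin k) u => f u (e i)) _ (fun i _ => hf _)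
  · intro u
    set m := Finset.univ.inf' Finset.univ_nonempty (fun e : Fin k ↪ s =>
      Finset.univ.sup' Finset.univ_nonempty (fun i : Fin k => f u (e i))) with hm
    change k ≤ (s.filter (fun a => f u a ≤ m)).card ∧ k ≤ (s.filter (fun a => m ≤ f u a)).card
    constructor
    · obtain ⟨e, _, he⟩ := Finset.exists_mem_eq_inf' (s := Finset.univ) Finset.univ_nonempty (fun e : Fin k ↪ s =>
        Finset.univ.sup' Finset.univ_nonempty (fun i : Fin k => f u (e i)))
      have : (Finset.univ.image (fun i => ((e i : s) : α))) ⊆ s.filter (fun a => f u a ≤ m) := by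
        intro a ha
        rw [Finset.mem_image] at ha
        obtain ⟨i, _, rfl⟩ := ha
        rw [Finset.mem_filter]
        refine ⟨(e i).2, ?_⟩
        rw [hm, he]
        exact Finset.le_sup' (fun i : Fin k => f u (e i)) (Finset.mem_univ i)
      have h2 := Finset.card_le_card this
      rw [Finset.card_image_of_injective _ (f := fun i => ((e i : s) : α)) (Subtype.val_injective.comp e.injective)] at h2
      simpa using h2
    · by_contra hcon
      have hpart := Finset.card_filter_add_card_filter_not (s := s) (fun a => m ≤ f u a)
      have : k ≤ (s.filter (fun a => ¬ m ≤ f u a)).card := by omega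
      obtain ⟨e⟩ := Function.Embedding.nonempty_of_card_le
        (α := Fin k) (β := (s.filter (fun a => ¬ m ≤ f u a))) (by simpa using this)
      let e' : Fin k ↪ s := ⟨fun i => ⟨(e i).1, (Finset.mem_filter.1 (e i).2).1⟩, by
        intro i j hij
        apply e.injective
        simpa [Subtype.ext_iff] using hij⟩
      have h1 : m ≤ _ := Finset.inf'_le (fun e : Fin k ↪ s =>
        Finset.univ.sup' Finset.univ_nonempty (fun i : Fin k => f u (e i))) (Finset.mem_univ e')
      obtain ⟨i, _, hi⟩ := Finset.exists_mem_eq_sup' (s := Finset.univ) Finset.univ_nonempty (fun i : Fin k => f u (e' i))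
      rw [hi] at h1
      exact (Finset.mem_filter.1 (e i).2).2 h1

theorem ham {α : Type*} [LinearOrder α] (p : α → Pt) (hp : StrictMono (fun a => (p a).1))
    (A C : Finset α) (hAC : ∀ a ∈ A, ∀ c ∈ C, a < c) (k : ℕ) (hk : 0 < k)
    (hA : 2 * k ≤ A.card) (hC : 2 * k ≤ C.card) :
    ∃ u v : ℝ, k ≤ (A.filter (fun a => (p a).2 - u * (p a).1 ≤ v)).card ∧
      k ≤ (A.filter (fun a => v ≤ (p a).2 - u * (p a).1)).card ∧
      k ≤ (C.filter (fun a => (p a).2 - u * (p a).1 ≤ v)).card ∧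
      k ≤ (C.filter (fun a => v ≤ (p a).2 - u * (p a).1)).card := by
  obtain ⟨M, hM, hM2⟩ := exists_median A k hk hA (fun u a => (p a).2 - u * (p a).1) (fun a => by fun_prop)
  obtain ⟨M', hM', hM2'⟩ := exists_median C k hk hC (fun u a => (p a).2 - u * (p a).1) (fun a => by fun_prop)
  have hbd : ∃ W : ℝ, ∀ a ∈ A, ∀ c ∈ C, |((p c).2 - (p a).2) / ((p c).1 - (p a).1)| ≤ W := by
    refine ⟨∑ a ∈ A, ∑ c ∈ C, |((p c).2 - (p a).2) / ((p c).1 - (p a).1)|, ?_⟩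
    intro a ha c hc
    refine le_trans ?_ (Finset.single_le_sum (f := fun a => ∑ c ∈ C, |((p c).2 - (p a).2) / ((p c).1 - (p a).1)|) (fun i _ => Finset.sum_nonneg (fun j _ => abs_nonneg _)) ha)
    exact Finset.single_le_sum (f := fun c => |((p c).2 - (p a).2) / ((p c).1 - (p a).1)|) (fun j _ => abs_nonneg _) hc
  obtain ⟨W, hW⟩ := hbd
  have mem : ∀ {s : Finset α} , k ≤ s.card → ∃ a, a ∈ s := fun h =>
    (Finset.card_pos.1 (lt_of_lt_of_le hk h))
  have h1 : M' W ≤ M W := by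
    obtain ⟨a, ha⟩ := mem (hM2 W).1
    obtain ⟨c, hc⟩ := mem (hM2' W).2
    rw [Finset.mem_filter] at ha hc
    have hx : 0 < (p c).1 - (p a).1 := sub_pos.2 (hp (hAC a ha.1 c hc.1))
    have := (abs_le.1 (hW a ha.1 c hc.1)).2
    rw [div_le_iff₀ hx] at this
    linarith [ha.2, hc.2]
  have h2 : M (-W) ≤ M' (-W) := by
    obtain ⟨a, ha⟩ := mem (hM2 (-W)).2
    obtain ⟨c, hc⟩ := mem (hM2' (-W)).1
    rw [Finset.mem_filter] at ha hc
    have hx : 0 < (p c).1 - (p a).1 := sub_pos.2 (hp (hAC a ha.1 c hc.1))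
    have := (abs_le.1 (hW a ha.1 c hc.1)).1
    rw [le_div_iff₀ hx] at this
    linarith [ha.2, hc.2]
  obtain ⟨u, hu⟩ := intermediate_value_univ₂ hM hM' h2 h1
  refine ⟨u, M u, (hM2 u).1, (hM2 u).2, ?_, ?_⟩
  · rw [hu]; exact (hM2' u).1
  · rw [hu]; exact (hM2' u).2

theorem triple {α : Type*} [LinearOrder α] (p : α → Pt) (hp : StrictMono (fun a => (p a).1))
    (hgp : ∀ a b c, a ≠ b → a ≠ c → b ≠ c → ori (p a) (p b) (p c) ≠ 0)
    (A B C : Finset α) (hAB : ∀ a ∈ A, ∀ b ∈ B, a < b) (hBC : ∀ b ∈ B, ∀ c ∈ C, b < c)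
    (k : ℕ) (hk : 0 < k)
    (hA : 4 * k ≤ A.card) (hB : 4 * k ≤ B.card) (hC : 4 * k ≤ C.card) :
    ∃ A' ⊆ A, ∃ B' ⊆ B, ∃ C' ⊆ C, k ≤ A'.card ∧ k ≤ B'.card ∧ k ≤ C'.card ∧
      ((∀ a ∈ A', ∀ b ∈ B', ∀ c ∈ C', 0 < ori (p a) (p b) (p c)) ∨
       (∀ a ∈ A', ∀ b ∈ B', ∀ c ∈ C', ori (p a) (p b) (p c) < 0)) := by
  have hAC : ∀ a ∈ A, ∀ c ∈ C, a < c := by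
    intro a ha c hc
    obtain ⟨b, hb⟩ : B.Nonempty := Finset.card_pos.1 (by omega)
    exact (hAB a ha b hb).trans (hBC b hb c hc)
  obtain ⟨u, v, h1, h2, h3, h4⟩ := ham p hp A C hAC k hk (by omega) (by omega)
  have hon : (B.filter (fun b => (p b).2 - u * (p b).1 = v)).card ≤ 2 := by
    by_contra hcon
    obtain ⟨a, ha, b, hb, c, hc, hab, hac, hbc⟩ := Finset.two_lt_card.1 (not_le.1 hcon)
    rw [Finset.mem_filter] at ha hb hc
    apply hgp a b c hab hac hbc
    unfold ori
    have e1 : (p a).2 = v + u * (p a).1 := by linarith [ha.2]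
    have e2 : (p b).2 = v + u * (p b).1 := by linarith [hb.2]
    have e3 : (p c).2 = v + u * (p c).1 := by linarith [hc.2]
    rw [e1, e2, e3]
    ring
  have hsum : B.card ≤ (B.filter (fun b => (p b).2 - u * (p b).1 = v)).card
      + (B.filter (fun b => v < (p b).2 - u * (p b).1)).card
      + (B.filter (fun b => (p b).2 - u * (p b).1 < v)).card := by
    refine le_trans (Finset.card_le_card (t := B.filter (fun b => (p b).2 - u * (p b).1 = v) ∪
      B.filter (fun b => v < (p b).2 - u * (p b).1) ∪ B.filter (fun b => (p b).2 - u * (p b).1 < v)) ?_) ?_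
    · intro b hb
      simp only [Finset.mem_union, Finset.mem_filter, hb, true_and]
      rcases lt_trichotomy ((p b).2 - u * (p b).1) v with h | h | h
      · exact Or.inr h
      · exact Or.inl (Or.inl h)
      · exact Or.inl (Or.inr h)
    · refine (Finset.card_union_le _ _).trans ?_
      gcongr
      exact Finset.card_union_le _ _
  have hid : ∀ a b c : Pt, ori a b c = (b.1 - a.1) * (c.2 - u * c.1 - v) - (c.1 - a.1) * (b.2 - u * b.1 - v)
      + (c.1 - b.1) * (a.2 - u * a.1 - v) := by
    intro a b c; unfold ori; ring
  by_cases hcase : k ≤ (B.filter (fun b => v < (p b).2 - u * (p b).1)).card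
  · refine ⟨_, Finset.filter_subset _ _, _, Finset.filter_subset _ _, _, Finset.filter_subset _ _, h1, hcase, h3, Or.inr ?_⟩
    intro a ha b hb c hc
    rw [Finset.mem_filter] at ha hb hc
    have x1 : (p a).1 < (p b).1 := hp (hAB a ha.1 b hb.1)
    have x2 : (p b).1 < (p c).1 := hp (hBC b hb.1 c hc.1)
    rw [hid]
    nlinarith [mul_nonneg (sub_pos.2 x1).le (sub_nonneg.2 hc.2), mul_nonneg (sub_pos.2 x2).le (sub_nonneg.2 ha.2),
      mul_pos (sub_pos.2 (x1.trans x2)) (sub_pos.2 hb.2)]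
  · refine ⟨_, Finset.filter_subset _ _, B.filter (fun b => (p b).2 - u * (p b).1 < v), Finset.filter_subset _ _, _, Finset.filter_subset _ _, h2, ?_, h4, Or.inl ?_⟩
    · omega
    intro a ha b hb c hc
    rw [Finset.mem_filter] at ha hb hc
    have x1 : (p a).1 < (p b).1 := hp (hAB a ha.1 b hb.1)
    have x2 : (p b).1 < (p c).1 := hp (hBC b hb.1 c hc.1)
    rw [hid]
    nlinarith [mul_nonneg (sub_pos.2 x1).le (sub_nonneg.2 hc.2), mul_nonneg (sub_pos.2 x2).le (sub_nonneg.2 ha.2),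
      mul_pos (sub_pos.2 (x1.trans x2)) (sub_pos.2 hb.2)]

/-- The clusters of a triple of indices are homogeneous. -/
def Homog {α : Type*} (p : α → Pt) (A : ℕ → Finset α) (i j k : ℕ) : Prop :=
  (∀ a ∈ A i, ∀ b ∈ A j, ∀ c ∈ A k, 0 < ori (p a) (p b) (p c)) ∨
       (∀ a ∈ A i, ∀ b ∈ A j, ∀ c ∈ A k, ori (p a) (p b) (p c) < 0)

theorem homog_mono {α : Type*} (p : α → Pt) (A B : ℕ → Finset α) (h : ∀ i, B i ⊆ A i) (i j k : ℕ)
    (hA : Homog p A i j k) : Homog p B i j k := by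
  rcases hA with hA | hA
  · exact Or.inl fun a ha b hb c hc => hA a (h _ ha) b (h _ hb) c (h _ hc)
  · exact Or.inr fun a ha b hb c hc => hA a (h _ ha) b (h _ hb) c (h _ hc)

theorem sameType {α : Type*} [LinearOrder α] (p : α → Pt) (hp : StrictMono (fun a => (p a).1))
    (hgp : ∀ a b c, a ≠ b → a ≠ c → b ≠ c → ori (p a) (p b) (p c) ≠ 0) (R : ℕ)
    (T : Finset (ℕ × ℕ × ℕ)) (hT : ∀ t ∈ T, t.1 < t.2.1 ∧ t.2.1 < t.2.2 ∧ t.2.2 < R) :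
    ∀ (A : ℕ → Finset α) (_ : ∀ i j, i < j → j < R → ∀ a ∈ A i, ∀ b ∈ A j, a < b)
    (k : ℕ) (_ : 0 < k) (_ : ∀ i, i < R → 4 ^ T.card * k ≤ (A i).card),
    ∃ A' : ℕ → Finset α, (∀ i, A' i ⊆ A i) ∧ (∀ i, i < R → k ≤ (A' i).card) ∧
      ∀ t ∈ T, Homog p A' t.1 t.2.1 t.2.2 := by
  classical
  induction T using Finset.induction_on with
  | empty =>
    intro A hA k hk hc
    exact ⟨A, fun i => Finset.Subset.refl _, fun i hi => by simpa using hc i hi, by simp⟩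
  | insert t T htT ih =>
    intro A hA k hk hc
    rw [Finset.card_insert_of_notMem htT] at hc
    obtain ⟨A1, hA1, hc1, hh⟩ := ih (fun t' ht' => hT t' (Finset.mem_insert_of_mem ht')) A hA (4 * k) (by omega)
      (fun i hi => by have := hc i hi; rw [pow_succ] at this; linarith)
    obtain ⟨i, j, l⟩ := t
    obtain ⟨hij, hjl, hl⟩ := hT _ (Finset.mem_insert_self _ _)
    simp only at hij hjl hl
    obtain ⟨A', hA', B', hB', C', hC', ka, kb, kc, hor⟩ := triple p hp hgp (A1 i) (A1 j) (A1 l)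
      (fun a ha b hb => hA i j hij (by omega) a (hA1 _ ha) b (hA1 _ hb))
      (fun a ha b hb => hA j l hjl (by omega) a (hA1 _ ha) b (hA1 _ hb)) k hk
      (hc1 i (by omega)) (hc1 j (by omega)) (hc1 l hl)
    let A2 : ℕ → Finset α := fun x => if x = i then A' else if x = j then B' else if x = l then C' else A1 x
    have e1 : A2 i = A' := by simp [A2]
    have e2 : A2 j = B' := by simp [A2, hij.ne']
    have e3 : A2 l = C' := by simp [A2, hjl.ne', (hij.trans hjl).ne']
    have hsub : ∀ x, A2 x ⊆ A1 x := by
      intro x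
      simp only [A2]
      split_ifs with h1 h2 h3
      · rw [h1]; exact hA'
      · rw [h2]; exact hB'
      · rw [h3]; exact hC'
      · exact Finset.Subset.refl _
    refine ⟨A2, fun x => (hsub x).trans (hA1 x), ?_, ?_⟩
    · intro x hx
      simp only [A2]
      split_ifs with h1 h2 h3
      · exact ka
      · exact kb
      · exact kc
      · have := hc1 x hx; omega
    · intro t ht
      rw [Finset.mem_insert] at ht
      rcases ht with rfl | ht
      · unfold Homog
        rw [e1, e2, e3]
        exact hor
      · exact homog_mono p A1 A2 hsub _ _ _ (hh t ht)

/-- `S` is a union of at most `n` preconnected sets. -/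
def Cov {X : Type*} [TopologicalSpace X] (S : Set X) (n : ℕ) : Prop :=
  ∃ F : Finset (Set X), F.card ≤ n ∧ (∀ Z ∈ F, IsPreconnected Z ∧ Z ⊆ S) ∧ S ⊆ ⋃₀ (F : Set (Set X))

theorem cov_mono {X : Type*} [TopologicalSpace X] {S : Set X} {m n : ℕ} (h : Cov S m) (hmn : m ≤ n) :
    Cov S n := by
  obtain ⟨F, h1, h2⟩ := h
  exact ⟨F, h1.trans hmn, h2⟩

theorem cov_union {X : Type*} [TopologicalSpace X] {S T : Set X} {m n : ℕ} (h : Cov S m) (h' : Cov T n) :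
    Cov (S ∪ T) (m + n) := by
  classical
  obtain ⟨F, h1, h2, h3⟩ := h
  obtain ⟨G, g1, g2, g3⟩ := h'
  refine ⟨F ∪ G, (Finset.card_union_le _ _).trans (by omega), ?_, ?_⟩
  · intro Z hZ
    rcases Finset.mem_union.1 hZ with hZ | hZ
    · exact ⟨(h2 Z hZ).1, (h2 Z hZ).2.trans subset_union_left⟩
    · exact ⟨(g2 Z hZ).1, (g2 Z hZ).2.trans subset_union_right⟩
  · rw [Finset.coe_union, sUnion_union]
    exact union_subset_union h3 g3

theorem cov_one {X : Type*} [TopologicalSpace X] {S : Set X} (h : IsPreconnected S) : Cov S 1 :=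
  ⟨{S}, by simp, by simpa using h, by simp⟩

theorem cov_empty {X : Type*} [TopologicalSpace X] (n : ℕ) : Cov (∅ : Set X) n :=
  ⟨∅, by simp, by simp, by simp⟩

theorem cov_image {X Y : Type*} [TopologicalSpace X] [TopologicalSpace Y] {S : Set X} {n : ℕ}
    (h : Cov S n) (f : X → Y) (hf : Continuous f) : Cov (f '' S) n := by
  classical
  obtain ⟨F, h1, h2, h3⟩ := h
  refine ⟨F.image (fun Z => f '' Z), Finset.card_image_le.trans h1, ?_, ?_⟩
  · intro Z hZ
    obtain ⟨W, hW, rfl⟩ := Finset.mem_image.1 hZ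
    exact ⟨(h2 W hW).1.image f hf.continuousOn, image_mono (h2 W hW).2⟩
  · rintro _ ⟨x, hx, rfl⟩
    obtain ⟨Z, hZ, hxZ⟩ := h3 hx
    exact ⟨f '' Z, by simpa using ⟨Z, hZ, rfl⟩, ⟨x, hxZ, rfl⟩⟩

theorem compsLE_of_cov {S : Set Pt} {d : ℕ} (h : Cov S d) : CompsLE S d := by
  classical
  obtain ⟨F, h1, h2, h3⟩ := h
  intro f hf
  choose Z hZ hfZ using fun i => h3 (hf i)
  obtain ⟨i, _, j, _, hij, he⟩ := Finset.exists_ne_map_eq_of_card_lt_of_maps_to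
    (s := Finset.univ) (t := F) (f := Z) (by simpa using Nat.lt_succ_of_le h1) (fun i _ => hZ i)
  refine ⟨i, j, hij, ?_⟩
  have hp := h2 (Z i) (hZ i)
  have := hp.1.subset_connectedComponentIn (hfZ i) hp.2
  have hj : f j ∈ connectedComponentIn S (f i) := this (by rw [he]; exact hfZ j)
  exact connectedComponentIn_eq hj

/-- Supporting lines at every point. -/
def Supp (a b : ℝ) (φ : ℝ → ℝ) : Prop :=
  ∀ x ∈ Icc a b, ∃ s : ℝ, ∀ y ∈ Icc a b, φ x + s * (y - x) ≤ φ y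

theorem cov_supp {a b : ℝ} {φ : ℝ → ℝ} (h : Supp a b φ) : Cov {x | x ∈ Icc a b ∧ φ x = 0} 2 := by
  have key : ∀ x w y, x ∈ Icc a b → y ∈ Icc a b → x ≤ w → w ≤ y → φ x = 0 → φ y = 0 → φ w ≤ 0 := by
    intro x w y hx hy hxw hwy h0 h1
    obtain ⟨s, hs⟩ := h w ⟨hx.1.trans hxw, hwy.trans hy.2⟩
    have e1 := hs x hx
    have e2 := hs y hy
    by_contra hc
    rw [not_le] at hc
    rcases le_total 0 s with h | h
    · nlinarith [mul_nonneg h (sub_nonneg.2 hwy)]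
    · nlinarith [mul_nonneg (neg_nonneg.2 h) (sub_nonneg.2 hxw)]
  by_cases hz : ∃ z ∈ Icc a b, φ z < 0
  · obtain ⟨z, hz, hzn⟩ := hz
    have e : {x | x ∈ Icc a b ∧ φ x = 0} = {x | x ∈ Icc a b ∧ φ x = 0 ∧ x < z} ∪ {x | x ∈ Icc a b ∧ φ x = 0 ∧ z < x} := by
      ext x
      simp only [mem_ofPred_eq, mem_union]
      constructor
      · rintro ⟨h1, h2⟩
        rcases lt_trichotomy x z with h | h | h
        · exact Or.inl ⟨h1, h2, h⟩
        · rw [h] at h2; linarith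
        · exact Or.inr ⟨h1, h2, h⟩
      · rintro (h | h)
        · exact ⟨h.1, h.2.1⟩
        · exact ⟨h.1, h.2.1⟩
    rw [e]
    refine cov_union (m := 1) (n := 1) (cov_one ?_) (cov_one ?_)
    · apply OrdConnected.isPreconnected
      refine ⟨fun x hx y hy w hw => ?_⟩
      refine ⟨⟨hx.1.1.trans hw.1, hw.2.trans hy.1.2⟩, ?_, hw.2.trans_lt hy.2.2⟩
      apply le_antisymm (key x w y hx.1 hy.1 hw.1 hw.2 hx.2.1 hy.2.1)
      by_contra hc
      rw [not_le] at hc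
      obtain ⟨s, hs⟩ := h y hy.1
      have e1 := hs w ⟨hx.1.1.trans hw.1, hw.2.trans hy.1.2⟩
      have e2 := hs z hz
      have := hy.2.1
      rcases le_total 0 s with h | h
      · nlinarith [mul_nonneg h (sub_nonneg.2 hy.2.2.le)]
      · nlinarith [mul_nonneg (neg_nonneg.2 h) (sub_nonneg.2 hw.2)]
    · apply OrdConnected.isPreconnected
      refine ⟨fun x hx y hy w hw => ?_⟩
      refine ⟨⟨hx.1.1.trans hw.1, hw.2.trans hy.1.2⟩, ?_, hx.2.2.trans_le hw.1⟩
      apply le_antisymm (key x w y hx.1 hy.1 hw.1 hw.2 hx.2.1 hy.2.1)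
      by_contra hc
      rw [not_le] at hc
      obtain ⟨s, hs⟩ := h x hx.1
      have e1 := hs w ⟨hx.1.1.trans hw.1, hw.2.trans hy.1.2⟩
      have e2 := hs z hz
      have := hx.2.1
      rcases le_total 0 s with h | h
      · nlinarith [mul_nonneg h (sub_nonneg.2 hw.1)]
      · nlinarith [mul_nonneg (neg_nonneg.2 h) (sub_nonneg.2 hx.2.2.le)]
  · push Not at hz
    refine cov_mono (cov_one ?_) (by norm_num : 1 ≤ 2)
    apply OrdConnected.isPreconnected
    refine ⟨fun x hx y hy w hw => ?_⟩
    have hwI : w ∈ Icc a b := ⟨hx.1.1.trans hw.1, hw.2.trans hy.1.2⟩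
    exact ⟨hwI, le_antisymm (key x w y hx.1 hy.1 hw.1 hw.2 hx.2 hy.2) (hz w hwI)⟩

/-- Consecutive points of `Y`. -/
def Consec (Y : Finset Pt) (p q : Pt) : Prop :=
  p ∈ Y ∧ q ∈ Y ∧ p.1 < q.1 ∧ ∀ r ∈ Y, r.1 ≤ p.1 ∨ q.1 ≤ r.1

/-- `g` interpolates `Y`. -/
def Interp (Y : Finset Pt) (g : ℝ → ℝ) : Prop :=
  (∀ p ∈ Y, g p.1 = p.2) ∧ ∀ p q, Consec Y p q → ∀ x ∈ Icc p.1 q.1,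
    (q.1 - p.1) * g x = (q.1 - x) * p.2 + (x - p.1) * q.2

theorem min_lip (x y c : ℝ) : |min x c - min y c| ≤ |x - y| := by
  rcases min_cases x c with h | h <;> rcases min_cases y c with h' | h' <;>
    rcases abs_cases (x - y) with h2 | h2 <;>
    rw [h.1, h'.1, abs_le] <;> constructor <;> linarith [h.2, h'.2, h2.1, h2.2]

theorem max_lip (x y c : ℝ) : |max 0 (x - c) - max 0 (y - c)| ≤ |x - y| := by
  rcases max_cases 0 (x - c) with h | h <;> rcases max_cases 0 (y - c) with h' | h' <;>
    rcases abs_cases (x - y) with h2 | h2 <;>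
    rw [h.1, h'.1, abs_le] <;> constructor <;> linarith [h.2, h'.2, h2.1, h2.2]

theorem exists_interp (Y : Finset Pt) : InjOn Prod.fst (Y : Set Pt) → Y.Nonempty →
    ∃ (g : ℝ → ℝ) (M : ℝ), 0 ≤ M ∧ (∀ x y, |g x - g y| ≤ M * |x - y|) ∧ Interp Y g := by
  classical
  induction Y using Finset.induction_on_max_value (fun p : Pt => p.1) with
  | empty => intro _ h; exact absurd h (by simp)
  | insert a s has hmax ih =>
    intro hinj _
    rcases s.eq_empty_or_nonempty with rfl | hne
    · refine ⟨fun _ => a.2, 0, le_refl _, by simp, by simp, ?_⟩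
      rintro p q ⟨hp, hq, hpq, _⟩
      simp only [insert_empty_eq, Finset.mem_singleton] at hp hq
      rw [hp, hq] at hpq
      exact absurd hpq (lt_irrefl _)
    · obtain ⟨g, M, hM, hlip, hg, hcon⟩ := ih (hinj.mono (by simp)) hne
      obtain ⟨q, hq, hqm⟩ := s.exists_max_image (fun p : Pt => p.1) hne
      have hlt : ∀ p ∈ s, p.1 < a.1 := by
        intro p hp
        refine lt_of_le_of_ne (hmax p hp) ?_
        intro he
        have : p = a := hinj (by simp [hp]) (by simp) he
        rw [this] at hp
        exact has hp
      have hqa := hlt q hq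
      set m := (a.2 - q.2) / (a.1 - q.1) with hm
      have hmm : m * (a.1 - q.1) = a.2 - q.2 := div_mul_cancel₀ _ (sub_pos.2 hqa).ne'
      have hlow : ∀ x, x ≤ q.1 → g (min x q.1) + m * max 0 (x - q.1) = g x := by
        intro x hx
        rw [min_eq_left hx, max_eq_left (by linarith)]; ring
      have hhigh : ∀ x, q.1 ≤ x → g (min x q.1) + m * max 0 (x - q.1) = q.2 + m * (x - q.1) := by
        intro x hx
        rw [min_eq_right hx, max_eq_right (by linarith), hg q hq]
      refine ⟨fun x => g (min x q.1) + m * max 0 (x - q.1), M + |m|, by positivity, ?_, ?_, ?_⟩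
      · intro x y
        have e1 := (hlip (min x q.1) (min y q.1)).trans (mul_le_mul_of_nonneg_left (min_lip x y q.1) hM)
        have e2 := mul_le_mul_of_nonneg_left (max_lip x y q.1) (abs_nonneg m)
        rw [← abs_mul] at e2
        have e3 := abs_add_le (g (min x q.1) - g (min y q.1)) (m * (max 0 (x - q.1) - max 0 (y - q.1)))
        have e4 : g (min x q.1) + m * max 0 (x - q.1) - (g (min y q.1) + m * max 0 (y - q.1)) =
          (g (min x q.1) - g (min y q.1)) + (m * (max 0 (x - q.1) - max 0 (y - q.1))) := by ring
        rw [e4]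
        linarith
      · intro p hp
        rcases Finset.mem_insert.1 hp with rfl | hp
        · simp only
          rw [hhigh _ hqa.le, hmm]; ring
        · simp only
          rw [hlow _ (hqm p hp), hg p hp]
      · rintro p r ⟨hp, hr, hpr, hcons⟩ x hx
        simp only
        rcases Finset.mem_insert.1 hr with rfl | hrs
        · rcases Finset.mem_insert.1 hp with rfl | hp
          · exact absurd hpr (lt_irrefl _)
          · have hpq : p = q := by
              rcases hcons q (Finset.mem_insert_of_mem hq) with h | h
              · exact hinj (by simp [hp]) (by simp [hq]) (le_antisymm (hqm p hp) h)
              · exact absurd hqa (not_lt.2 h)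
            rw [hpq] at hx ⊢
            rw [hhigh x hx.1]
            linear_combination (x - q.1) * hmm
        · rcases Finset.mem_insert.1 hp with rfl | hp
          · exact absurd hpr (hlt r hrs).asymm
          · rw [hlow x (hx.2.trans (hqm r hrs))]
            exact hcon p r ⟨hp, hrs, hpr, fun z hz => hcons z (Finset.mem_insert_of_mem hz)⟩ x hx

theorem locate (Y : Finset Pt) (a b : Pt) (ha : a ∈ Y) (hb : b ∈ Y) (hab : a.1 < b.1) (x : ℝ)
    (hx : x ∈ Icc a.1 b.1) : ∃ p q, Consec Y p q ∧ x ∈ Icc p.1 q.1 ∧ a.1 ≤ p.1 ∧ q.1 ≤ b.1 := by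
  classical
  rcases hx.2.eq_or_lt with h | h
  · obtain ⟨p, hp, hpm⟩ := (Y.filter (fun r => r.1 < x)).exists_max_image (fun r => r.1)
      ⟨a, by simp [ha, h, hab]⟩
    obtain ⟨q, hq, hqm⟩ := (Y.filter (fun r => x ≤ r.1)).exists_min_image (fun r => r.1)
      ⟨b, by simp [hb, h]⟩
    rw [Finset.mem_filter] at hp hq
    refine ⟨p, q, ⟨hp.1, hq.1, hp.2.trans_le hq.2, ?_⟩, ⟨hp.2.le, hq.2⟩, ?_, ?_⟩
    · intro r hr
      rcases lt_or_ge r.1 x with h | h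
      · exact Or.inl (hpm r (by simp [hr, h]))
      · exact Or.inr (hqm r (by simp [hr, h]))
    · exact hpm a (by simp [ha, h, hab])
    · exact hqm b (by simp [hb, h])
  · obtain ⟨p, hp, hpm⟩ := (Y.filter (fun r => r.1 ≤ x)).exists_max_image (fun r => r.1)
      ⟨a, by simp [ha, hx.1]⟩
    obtain ⟨q, hq, hqm⟩ := (Y.filter (fun r => x < r.1)).exists_min_image (fun r => r.1)
      ⟨b, by simp [hb, h]⟩
    rw [Finset.mem_filter] at hp hq
    refine ⟨p, q, ⟨hp.1, hq.1, hp.2.trans_lt hq.2, ?_⟩, ⟨hp.2, hq.2.le⟩, ?_, ?_⟩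
    · intro r hr
      rcases le_or_gt r.1 x with h | h
      · exact Or.inl (hpm r (by simp [hr, h]))
      · exact Or.inr (hqm r (by simp [hr, h]))
    · exact hpm a (by simp [ha, hx.1])
    · exact hqm b (by simp [hb, h])

theorem supp_interp (Y : Finset Pt) (hinj : InjOn Prod.fst (Y : Set Pt)) (g : ℝ → ℝ) (hg : Interp Y g)
    (a b : Pt) (ha : a ∈ Y) (hb : b ∈ Y) (hab : a.1 < b.1) (σ : ℝ)
    (hσ : ∀ p ∈ Y, ∀ q ∈ Y, ∀ r ∈ Y, a.1 ≤ p.1 → p.1 < q.1 → q.1 < r.1 → r.1 ≤ b.1 → 0 ≤ σ * ori p q r)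
    (u v : ℝ) :
    Supp a.1 b.1 (fun x => σ * (g x - (u * x + v))) := by
  intro x hx
  obtain ⟨p, q, hc, hxpq, hap, hqb⟩ := locate Y a b ha hb hab x hx
  have hpq : 0 < q.1 - p.1 := sub_pos.2 hc.2.2.1
  set m := (q.2 - p.2) / (q.1 - p.1) with hm
  have hmm : m * (q.1 - p.1) = q.2 - p.2 := div_mul_cancel₀ _ hpq.ne'
  have hgx : g x = p.2 + m * (x - p.1) := by
    have := hg.2 p q hc x hxpq
    apply mul_left_cancel₀ hpq.ne'
    rw [this]
    linear_combination (-(x - p.1)) * hmm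
  have hv : ∀ r ∈ Y, a.1 ≤ r.1 → r.1 ≤ b.1 → 0 ≤ σ * (r.2 - p.2 - m * (r.1 - p.1)) := by
    intro r hr har hrb
    rcases hc.2.2.2 r hr with h | h
    · rcases h.eq_or_lt with h | h
      · have : r = p := hinj hr hc.1 h
        rw [this]; simp
      · have := hσ r hr p hc.1 q hc.2.1 har h hc.2.2.1 hqb
        refine nonneg_of_mul_nonneg_right (a := q.1 - p.1) ?_ hpq
        have e : σ * ori r p q = (q.1 - p.1) * (σ * (r.2 - p.2 - m * (r.1 - p.1))) := by
          unfold ori; linear_combination σ * (p.1 - r.1) * (-hmm)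
        rw [← e]; exact this
    · rcases h.eq_or_lt with h | h
      · have : r = q := hinj hr hc.2.1 h.symm
        rw [this, hmm]; simp
      · have := hσ p hc.1 q hc.2.1 r hr hap hc.2.2.1 h hrb
        refine nonneg_of_mul_nonneg_right (a := q.1 - p.1) ?_ hpq
        have e : σ * ori p q r = (q.1 - p.1) * (σ * (r.2 - p.2 - m * (r.1 - p.1))) := by
          unfold ori; linear_combination σ * (r.1 - p.1) * (hmm)
        rw [← e]; exact this
  refine ⟨σ * (m - u), ?_⟩
  intro y hy
  obtain ⟨p', q', hc', hy', hap', hqb'⟩ := locate Y a b ha hb hab y hy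
  have hpq' : 0 < q'.1 - p'.1 := sub_pos.2 hc'.2.2.1
  have e1 := hv p' hc'.1 hap' (hc'.2.2.1.le.trans hqb')
  have e2 := hv q' hc'.2.1 (hap'.trans hc'.2.2.1.le) hqb'
  have hgy := hg.2 p' q' hc' y hy'
  have key : 0 ≤ σ * (g y - p.2 - m * (y - p.1)) := by
    refine nonneg_of_mul_nonneg_right (a := q'.1 - p'.1) ?_ hpq'
    have e : (q'.1 - p'.1) * (σ * (g y - p.2 - m * (y - p.1))) =
      (q'.1 - y) * (σ * (p'.2 - p.2 - m * (p'.1 - p.1))) + (y - p'.1) * (σ * (q'.2 - p.2 - m * (q'.1 - p.1))) := by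
      linear_combination σ * hgy
    rw [e]
    exact add_nonneg (mul_nonneg (sub_nonneg.2 hy'.2) e1) (mul_nonneg (sub_nonneg.2 hy'.1) e2)
  simp only
  rw [hgx]
  linarith

/-- The part of the graph of `g` over `[a, b]` on the line. -/
theorem cov_piece (Y : Finset Pt) (hinj : InjOn Prod.fst (Y : Set Pt)) (g : ℝ → ℝ) (hg : Interp Y g)
    (a b : Pt) (ha : a ∈ Y) (hb : b ∈ Y) (hab : a.1 < b.1) (σ : ℝ) (hσ0 : σ ≠ 0)
    (hσ : ∀ p ∈ Y, ∀ q ∈ Y, ∀ r ∈ Y, a.1 ≤ p.1 → p.1 < q.1 → q.1 < r.1 → r.1 ≤ b.1 → 0 ≤ σ * ori p q r)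
    (u v : ℝ) : Cov {x | x ∈ Icc a.1 b.1 ∧ g x = u * x + v} 2 := by
  have := cov_supp (supp_interp Y hinj g hg a b ha hb hab σ hσ u v)
  convert this using 4
  simp [hσ0, sub_eq_zero]

/-- The crossing points of the graph with the line on gaps of a given kind. -/
def Gap (Y : Finset Pt) (g : ℝ → ℝ) (u v : ℝ) (P : Pt → Pt → Prop) : Set ℝ :=
  {x | ∃ p q, Consec Y p q ∧ P p q ∧ x ∈ Icc p.1 q.1 ∧ g x = u * x + v}

theorem cov_gap_unique (Y : Finset Pt) (hinj : InjOn Prod.fst (Y : Set Pt)) (g : ℝ → ℝ) (hg : Interp Y g)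
    (u v : ℝ) (P : Pt → Pt → Prop)
    (huniq : ∀ p q p' q', Consec Y p q → Consec Y p' q' → P p q → P p' q' → p = p' ∧ q = q') :
    Cov (Gap Y g u v P) 2 := by
  by_cases h : ∃ p q, Consec Y p q ∧ P p q
  · obtain ⟨p, q, hc, hP⟩ := h
    have e : Gap Y g u v P = {x | x ∈ Icc p.1 q.1 ∧ g x = u * x + v} := by
      ext x
      constructor
      · rintro ⟨p', q', hc', hP', hx, hgx⟩
        obtain ⟨rfl, rfl⟩ := huniq p q p' q' hc hc' hP hP'
        exact ⟨hx, hgx⟩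
      · rintro ⟨hx, hgx⟩
        exact ⟨p, q, hc, hP, hx, hgx⟩
    rw [e]
    refine cov_piece Y hinj g hg p q hc.1 hc.2.1 hc.2.2.1 1 one_ne_zero ?_ u v
    intro a _ b hb c _ hpa hab hbc hcq
    exfalso
    rcases hc.2.2.2 b hb with h | h <;> linarith
  · have e : Gap Y g u v P = ∅ := by
      ext x
      simp only [mem_empty_iff_false, iff_false]
      rintro ⟨p, q, hc, hP, _⟩
      exact h ⟨p, q, hc, hP⟩
    rw [e]
    exact cov_empty 2

theorem cov_cluster (Y : Finset Pt) (hinj : InjOn Prod.fst (Y : Set Pt)) (g : ℝ → ℝ) (hg : Interp Y g)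
    (u v : ℝ) (c : Pt → ℕ) (hc : ∀ p ∈ Y, ∀ q ∈ Y, p.1 ≤ q.1 → c p ≤ c q) (i : ℕ)
    (hi : (∀ p ∈ Y, ∀ q ∈ Y, ∀ r ∈ Y, c p = i → c q = i → c r = i → p.1 < q.1 → q.1 < r.1 → 0 ≤ ori p q r) ∨
      (∀ p ∈ Y, ∀ q ∈ Y, ∀ r ∈ Y, c p = i → c q = i → c r = i → p.1 < q.1 → q.1 < r.1 → ori p q r ≤ 0)) :
    Cov (Gap Y g u v (fun p q => c p = i ∧ c q = i)) 2 := by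
  classical
  by_cases h : ∃ p q, Consec Y p q ∧ c p = i ∧ c q = i
  · obtain ⟨p, q, hpq, hp, hq⟩ := h
    obtain ⟨a, ha, ham⟩ := (Y.filter (fun r => c r = i)).exists_min_image (fun r => r.1)
      ⟨p, by simp [hpq.1, hp]⟩
    obtain ⟨b, hb, hbm⟩ := (Y.filter (fun r => c r = i)).exists_max_image (fun r => r.1)
      ⟨q, by simp [hpq.2.1, hq]⟩
    have hap := ham p (by simp [hpq.1, hp])
    have hqb := hbm q (by simp [hpq.2.1, hq])
    rw [Finset.mem_filter] at ha hb
    have hab : a.1 < b.1 := (hap.trans_lt hpq.2.2.1).trans_le hqb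
    have hin : ∀ r ∈ Y, a.1 ≤ r.1 → r.1 ≤ b.1 → c r = i := by
      intro r hr h1 h2
      have e1 := hc a ha.1 r hr h1
      have e2 := hc r hr b hb.1 h2
      omega
    have e : Gap Y g u v (fun p q => c p = i ∧ c q = i) = {x | x ∈ Icc a.1 b.1 ∧ g x = u * x + v} := by
      ext x
      constructor
      · rintro ⟨p', q', hc', hP', hx, hgx⟩
        refine ⟨⟨(ham p' (by simp [hc'.1, hP'.1])).trans hx.1, hx.2.trans (hbm q' (by simp [hc'.2.1, hP'.2]))⟩, hgx⟩
      · rintro ⟨hx, hgx⟩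
        obtain ⟨p', q', hc', hx', h1, h2⟩ := locate Y a b ha.1 hb.1 hab x hx
        exact ⟨p', q', hc', ⟨hin p' hc'.1 h1 (hc'.2.2.1.le.trans h2), hin q' hc'.2.1 (h1.trans hc'.2.2.1.le) h2⟩, hx', hgx⟩
    rw [e]
    rcases hi with hi | hi
    · refine cov_piece Y hinj g hg a b ha.1 hb.1 hab 1 one_ne_zero ?_ u v
      intro p hp q hq r hr h1 h2 h3 h4
      have := hi p hp q hq r hr (hin p hp h1 (by linarith)) (hin q hq (by linarith) (by linarith)) (hin r hr (by linarith) h4) h2 h3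
      linarith
    · refine cov_piece Y hinj g hg a b ha.1 hb.1 hab (-1) (by norm_num) ?_ u v
      intro p hp q hq r hr h1 h2 h3 h4
      have := hi p hp q hq r hr (hin p hp h1 (by linarith)) (hin q hq (by linarith) (by linarith)) (hin r hr (by linarith) h4) h2 h3
      linarith
  · have e : Gap Y g u v (fun p q => c p = i ∧ c q = i) = ∅ := by
      ext x
      simp only [mem_empty_iff_false, iff_false]
      rintro ⟨p, q, hc, hP, _⟩
      exact h ⟨p, q, hc, hP⟩
    rw [e]
    exact cov_empty 2

theorem cov_touch (Y : Finset Pt) (hinj : InjOn Prod.fst (Y : Set Pt)) (g : ℝ → ℝ) (hg : Interp Y g)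
    (u v : ℝ) (c : Pt → ℕ) (hc : ∀ p ∈ Y, ∀ q ∈ Y, p.1 ≤ q.1 → c p ≤ c q) (i : ℕ)
    (hi : (∀ p ∈ Y, ∀ q ∈ Y, ∀ r ∈ Y, c p = i → c q = i → c r = i → p.1 < q.1 → q.1 < r.1 → 0 ≤ ori p q r) ∨
      (∀ p ∈ Y, ∀ q ∈ Y, ∀ r ∈ Y, c p = i → c q = i → c r = i → p.1 < q.1 → q.1 < r.1 → ori p q r ≤ 0)) :
    Cov (Gap Y g u v (fun p q => c p = i ∨ c q = i)) 6 := by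
  have e : Gap Y g u v (fun p q => c p = i ∨ c q = i) =
      (Gap Y g u v (fun p q => c p = i ∧ c q = i) ∪ Gap Y g u v (fun p q => c p = i ∧ c q ≠ i)) ∪
      Gap Y g u v (fun p q => c p ≠ i ∧ c q = i) := by
    ext x
    constructor
    · rintro ⟨p, q, h1, h2, h3⟩
      by_cases hp : c p = i <;> by_cases hq : c q = i
      · exact Or.inl (Or.inl ⟨p, q, h1, ⟨hp, hq⟩, h3⟩)
      · exact Or.inl (Or.inr ⟨p, q, h1, ⟨hp, hq⟩, h3⟩)
      · exact Or.inr ⟨p, q, h1, ⟨hp, hq⟩, h3⟩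
      · tauto
    · rintro ((⟨p, q, h1, h2, h3⟩ | ⟨p, q, h1, h2, h3⟩) | ⟨p, q, h1, h2, h3⟩)
      · exact ⟨p, q, h1, Or.inl h2.1, h3⟩
      · exact ⟨p, q, h1, Or.inl h2.1, h3⟩
      · exact ⟨p, q, h1, Or.inr h2.2, h3⟩
  rw [e]
  have same : ∀ p q p' q', Consec Y p q → Consec Y p' q' → (p = p' ∨ q = q') → p = p' ∧ q = q' := by
    intro p q p' q' h h' he
    rcases he with rfl | rfl
    · refine ⟨rfl, hinj h.2.1 h'.2.1 (le_antisymm ?_ ?_)⟩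
      · rcases h.2.2.2 q' h'.2.1 with h1 | h1
        · linarith [h'.2.2.1]
        · exact h1
      · rcases h'.2.2.2 q h.2.1 with h1 | h1
        · linarith [h.2.2.1]
        · exact h1
    · refine ⟨hinj h.1 h'.1 (le_antisymm ?_ ?_), rfl⟩
      · rcases h'.2.2.2 p h.1 with h1 | h1
        · exact h1
        · linarith [h.2.2.1]
      · rcases h.2.2.2 p' h'.1 with h1 | h1
        · exact h1
        · linarith [h'.2.2.1]
  refine cov_union (m := 4) (n := 2) (cov_union (m := 2) (n := 2) (cov_cluster Y hinj g hg u v c hc i hi) ?_) ?_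
  · apply cov_gap_unique Y hinj g hg u v
    intro p q p' q' h h' hP hP'
    apply same p q p' q' h h'
    left
    have hlt : c p < c q := lt_of_le_of_ne (hc p h.1 q h.2.1 h.2.2.1.le) (by rw [hP.1]; exact Ne.symm hP.2)
    have hlt' : c p' < c q' := lt_of_le_of_ne (hc p' h'.1 q' h'.2.1 h'.2.2.1.le) (by rw [hP'.1]; exact Ne.symm hP'.2)
    apply hinj h.1 h'.1
    apply le_antisymm
    · rcases h'.2.2.2 p h.1 with h1 | h1
      · exact h1
      · have := hc _ h'.2.1 _ h.1 h1
        omega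
    · rcases h.2.2.2 p' h'.1 with h1 | h1
      · exact h1
      · have := hc _ h.2.1 _ h'.1 h1
        omega
  · apply cov_gap_unique Y hinj g hg u v
    intro p q p' q' h h' hP hP'
    apply same p q p' q' h h'
    right
    have hlt : c p < c q := lt_of_le_of_ne (hc p h.1 q h.2.1 h.2.2.1.le) (by rw [hP.2]; exact hP.1)
    have hlt' : c p' < c q' := lt_of_le_of_ne (hc p' h'.1 q' h'.2.1 h'.2.2.1.le) (by rw [hP'.2]; exact hP'.1)
    apply hinj h.2.1 h'.2.1
    apply le_antisymm
    · rcases h.2.2.2 q' h'.2.1 with h1 | h1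
      · have := hc _ h'.2.1 _ h.1 h1
        omega
      · exact h1
    · rcases h'.2.2.2 q h.2.1 with h1 | h1
      · have := hc _ h.2.1 _ h'.1 h1
        omega
      · exact h1

theorem cov_graph (Y : Finset Pt) (hinj : InjOn Prod.fst (Y : Set Pt)) (g : ℝ → ℝ) (hg : Interp Y g)
    (u v : ℝ) (c : Pt → ℕ) (hc : ∀ p ∈ Y, ∀ q ∈ Y, p.1 ≤ q.1 → c p ≤ c q)
    (hi : ∀ i, (∀ p ∈ Y, ∀ q ∈ Y, ∀ r ∈ Y, c p = i → c q = i → c r = i → p.1 < q.1 → q.1 < r.1 → 0 ≤ ori p q r) ∨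
      (∀ p ∈ Y, ∀ q ∈ Y, ∀ r ∈ Y, c p = i → c q = i → c r = i → p.1 < q.1 → q.1 < r.1 → ori p q r ≤ 0))
    (τ : ℝ) (hτ : ∀ p ∈ Y, ∀ q ∈ Y, ∀ r ∈ Y, c p < c q → c q < c r → 0 < τ * ori p q r)
    (hτ0 : τ ≠ 0)
    (a b : Pt) (ha : a ∈ Y) (hb : b ∈ Y) (hab : a.1 < b.1) (ham : ∀ r ∈ Y, a.1 ≤ r.1)
    (hbm : ∀ r ∈ Y, r.1 ≤ b.1) :
    Cov {x | x ∈ Icc a.1 b.1 ∧ g x = u * x + v} 12 := by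
  classical
  set φ : Pt → ℝ := fun p => τ * (p.2 - u * p.1 - v) with hφ
  have hne : ∀ p q, Consec Y p q → ∀ x ∈ Icc p.1 q.1, g x = u * x + v →
      (φ p ≤ 0 ∨ φ q ≤ 0) ∧ (0 ≤ φ p ∨ 0 ≤ φ q) := by
    intro p q h x hx hgx
    have h1 := hg.2 p q h x hx
    have h2 : (q.1 - x) * φ p + (x - p.1) * φ q = 0 := by
      simp only [hφ]
      linear_combination (-τ) * h1 + τ * (q.1 - p.1) * hgx
    have hpq := h.2.2.1
    constructor
    · by_contra hcon
      push Not at hcon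
      rcases hx.1.eq_or_lt with h3 | h3
      · nlinarith [mul_pos (sub_pos.2 hpq) hcon.1]
      · nlinarith [mul_pos (sub_pos.2 h3) hcon.2, mul_nonneg (sub_nonneg.2 hx.2) hcon.1.le]
    · by_contra hcon
      push Not at hcon
      rcases hx.1.eq_or_lt with h3 | h3
      · nlinarith [mul_pos (sub_pos.2 hpq) (neg_pos.2 hcon.1)]
      · nlinarith [mul_pos (sub_pos.2 h3) (neg_pos.2 hcon.2), mul_nonneg (sub_nonneg.2 hx.2) (neg_pos.2 hcon.1).le]
  have hmono : ∀ p ∈ Y, ∀ q ∈ Y, c p < c q → p.1 < q.1 := by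
    intro p hp q hq h
    by_contra hcon
    have := hc q hq p hp (not_lt.1 hcon)
    omega
  have hforb : ∀ p ∈ Y, ∀ q ∈ Y, ∀ r ∈ Y, c p < c q → c q < c r → φ p ≤ 0 → 0 ≤ φ q → φ r ≤ 0 → False := by
    intro p hp q hq r hr h1 h2 f1 f2 f3
    have h := hτ p hp q hq r hr h1 h2
    have x1 := hmono p hp q hq h1
    have x2 := hmono q hq r hr h2
    have hid : τ * ori p q r = (q.1 - p.1) * φ r - (r.1 - p.1) * φ q + (r.1 - q.1) * φ p := by
      simp only [hφ, ori]; ring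
    rw [hid] at h
    nlinarith [mul_nonneg (sub_pos.2 x1).le (neg_nonneg.2 f3), mul_nonneg (sub_pos.2 x2).le (neg_nonneg.2 f1),
      mul_nonneg (sub_pos.2 (x1.trans x2)).le f2]
  by_cases hU : (Y.filter (fun p => φ p ≤ 0)).Nonempty
  · obtain ⟨p0, hp0, hm0⟩ := (Y.filter (fun p => φ p ≤ 0)).exists_min_image (fun r => r.1) hU
    obtain ⟨p1, hp1, hm1⟩ := (Y.filter (fun p => φ p ≤ 0)).exists_max_image (fun r => r.1) hU
    rw [Finset.mem_filter] at hp0 hp1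
    have e : {x | x ∈ Icc a.1 b.1 ∧ g x = u * x + v} =
        Gap Y g u v (fun p q => c p = c p0 ∨ c q = c p0) ∪ Gap Y g u v (fun p q => c p = c p1 ∨ c q = c p1) := by
      ext x
      constructor
      · rintro ⟨hx, hgx⟩
        obtain ⟨p, q, hpq, hx', _, _⟩ := locate Y a b ha hb hab x hx
        have hs := hne p q hpq x hx' hgx
        by_contra hcon
        have n0 : ¬ (c p = c p0 ∨ c q = c p0) := fun h => hcon (Or.inl ⟨p, q, hpq, h, hx', hgx⟩)
        have n1 : ¬ (c p = c p1 ∨ c q = c p1) := fun h => hcon (Or.inr ⟨p, q, hpq, h, hx', hgx⟩)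
        push Not at n0 n1
        have hUb : ∀ s ∈ Y, φ s ≤ 0 → c p0 ≤ c s ∧ c s ≤ c p1 := by
          intro s hs hs'
          exact ⟨hc _ hp0.1 _ hs (hm0 s (by simp [hs, hs'])), hc _ hs _ hp1.1 (hm1 s (by simp [hs, hs']))⟩
        have hpq' := hc p hpq.1 q hpq.2.1 hpq.2.2.1.le
        have b0 : c p0 ≤ c p ∨ c q ≤ c p0 := by
          rcases hpq.2.2.2 p0 hp0.1 with h | h
          · exact Or.inl (hc _ hp0.1 _ hpq.1 h)
          · exact Or.inr (hc _ hpq.2.1 _ hp0.1 h)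
        have b1 : c p1 ≤ c p ∨ c q ≤ c p1 := by
          rcases hpq.2.2.2 p1 hp1.1 with h | h
          · exact Or.inl (hc _ hp1.1 _ hpq.1 h)
          · exact Or.inr (hc _ hpq.2.1 _ hp1.1 h)
        have hboth : c p0 < c p ∧ c p < c p1 ∧ c p0 < c q ∧ c q < c p1 := by
          rcases hs.1 with h | h
          · have := hUb p hpq.1 h
            omega
          · have := hUb q hpq.2.1 h
            omega
        rcases hs.2 with h | h
        · exact hforb p0 hp0.1 p hpq.1 p1 hp1.1 hboth.1 hboth.2.1 hp0.2 h hp1.2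
        · exact hforb p0 hp0.1 q hpq.2.1 p1 hp1.1 hboth.2.2.1 hboth.2.2.2 hp0.2 h hp1.2
      · rintro (⟨p, q, hpq, _, hx, hgx⟩ | ⟨p, q, hpq, _, hx, hgx⟩)
        · exact ⟨⟨(ham p hpq.1).trans hx.1, hx.2.trans (hbm q hpq.2.1)⟩, hgx⟩
        · exact ⟨⟨(ham p hpq.1).trans hx.1, hx.2.trans (hbm q hpq.2.1)⟩, hgx⟩
    rw [e]
    exact cov_union (m := 6) (n := 6) (cov_touch Y hinj g hg u v c hc _ (hi _)) (cov_touch Y hinj g hg u v c hc _ (hi _))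
  · have e : {x | x ∈ Icc a.1 b.1 ∧ g x = u * x + v} = ∅ := by
      ext x
      simp only [mem_empty_iff_false, iff_false]
      rintro ⟨hx, hgx⟩
      obtain ⟨p, q, hpq, hx', _, _⟩ := locate Y a b ha hb hab x hx
      rcases (hne p q hpq x hx' hgx).1 with h | h
      · exact hU ⟨p, by simp [hpq.1, h]⟩
      · exact hU ⟨q, by simp [hpq.2.1, h]⟩
    rw [e]
    exact cov_empty 12

theorem sphere_iff (z : EuclideanSpace ℝ (Fin 2)) : z ∈ Metric.sphere (0 : EuclideanSpace ℝ (Fin 2)) 1 ↔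
    z 0 ^ 2 + z 1 ^ 2 = 1 := by
  rw [mem_sphere_zero_iff_norm, EuclideanSpace.norm_eq, Real.sqrt_eq_one]
  simp [Fin.sum_univ_two]

theorem jordan_two_graphs (x0 x1 : ℝ) (hx : x0 < x1) (g h : ℝ → ℝ) (hg : Continuous g) (hh : Continuous h)
    (e0 : h x0 = g x0) (e1 : h x1 = g x1) (hlt : ∀ x, x0 < x → x < x1 → g x < h x) :
    IsJordanCurve {P : Pt | P.1 ∈ Icc x0 x1 ∧ (P.2 = g P.1 ∨ P.2 = h P.1)} := by
  set X : EuclideanSpace ℝ (Fin 2) → ℝ := fun z => (x0 + x1) / 2 + (x1 - x0) / 2 * z 0 with hX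
  have hXc : Continuous X := by simp only [hX]; fun_prop
  have hend : ∀ z ∈ Metric.sphere (0 : EuclideanSpace ℝ (Fin 2)) 1, z 1 = 0 → h (X z) = g (X z) := by
    intro z hz h0
    rw [sphere_iff, h0] at hz
    have : z 0 = 1 ∨ z 0 = -1 := by
      rw [← sq_eq_one_iff]; linarith
    rcases this with h2 | h2
    · have : X z = x1 := by simp only [hX, h2]; ring
      rw [this, e1]
    · have : X z = x0 := by simp only [hX, h2]; ring
      rw [this, e0]
  have hopen : ∀ z ∈ Metric.sphere (0 : EuclideanSpace ℝ (Fin 2)) 1, z 1 ≠ 0 → g (X z) < h (X z) := by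
    intro z hz h0
    rw [sphere_iff] at hz
    have : 0 < z 1 ^ 2 := by positivity
    have h3 : |z 0| < 1 := by rw [← sq_lt_one_iff_abs_lt_one]; linarith
    rw [abs_lt] at h3
    apply hlt
    · simp only [hX]; nlinarith
    · simp only [hX]; nlinarith
  refine ⟨fun z => (X z, if 0 ≤ z 1 then h (X z) else g (X z)), ?_, ?_, ?_⟩
  · rw [continuousOn_iff_continuous_domRestrict]
    refine Continuous.prodMk (hXc.comp continuous_subtype_val) ?_
    refine Continuous.if_le (hh.comp (hXc.comp continuous_subtype_val)) (hg.comp (hXc.comp continuous_subtype_val))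
      continuous_const (by fun_prop) ?_
    intro z hz
    exact hend z.1 z.2 hz.symm
  · intro z hz w hw hzw
    simp only [Prod.mk.injEq] at hzw
    obtain ⟨h1, h2⟩ := hzw
    have h0 : z 0 = w 0 := by
      simp only [hX] at h1
      have : (x1 - x0) / 2 * (z 0 - w 0) = 0 := by linarith
      rcases mul_eq_zero.1 this with h | h
      · linarith
      · linarith
    have hz' := hz
    have hw' := hw
    rw [sphere_iff] at hz' hw'
    have hsq : z 1 ^ 2 = w 1 ^ 2 := by rw [h0] at hz'; linarith
    have h3 : z 1 = w 1 := by
      rcases sq_eq_sq_iff_eq_or_eq_neg.1 hsq with h | h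
      · exact h
      · by_cases hw0 : w 1 = 0
        · rw [h, hw0]; simp
        · exfalso
          have hz0 : z 1 ≠ 0 := by rw [h]; simpa using hw0
          have o1 := hopen z hz hz0
          rw [← h1] at h2
          rcases lt_or_gt_of_ne hw0 with h4 | h4
          · rw [if_pos (by rw [h]; linarith), if_neg (by linarith)] at h2
            linarith
          · rw [if_neg (by rw [h]; linarith), if_pos (by linarith)] at h2
            linarith
    ext i
    fin_cases i
    · exact h0
    · exact h3
  · ext P
    constructor
    · rintro ⟨hP, hP2⟩
      have hd : 0 < x1 - x0 := by linarith
      set t := (2 * P.1 - x0 - x1) / (x1 - x0) with ht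
      have htt : t * (x1 - x0) = 2 * P.1 - x0 - x1 := div_mul_cancel₀ _ hd.ne'
      have ht1 : t ≤ 1 := by rw [ht, div_le_one hd]; linarith [hP.2]
      have ht2 : -1 ≤ t := by rw [ht, le_div_iff₀ hd]; linarith [hP.1]
      have hnn : 0 ≤ 1 - t ^ 2 := by nlinarith
      have hsq := Real.sq_sqrt hnn
      have hXP : ∀ s : ℝ, X !₂[t, s] = P.1 := by
        intro s
        simp only [hX]
        simp
        linarith
      rcases hP2 with h2 | h2
      · have hm : !₂[t, -√(1 - t ^ 2)] ∈ Metric.sphere (0 : EuclideanSpace ℝ (Fin 2)) 1 := by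
          rw [sphere_iff]; simp [hsq]
        refine ⟨!₂[t, -√(1 - t ^ 2)], hm, ?_⟩
        apply Prod.ext
        · exact hXP _
        · simp only
          split_ifs with hif
          · rw [hend _ hm, hXP, h2]
            have := Real.sqrt_nonneg (1 - t ^ 2)
            simp at hif ⊢
            linarith
          · rw [hXP, h2]
      · have hm : !₂[t, √(1 - t ^ 2)] ∈ Metric.sphere (0 : EuclideanSpace ℝ (Fin 2)) 1 := by
          rw [sphere_iff]; simp [hsq]
        refine ⟨!₂[t, √(1 - t ^ 2)], hm, ?_⟩
        apply Prod.ext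
        · exact hXP _
        · simp only
          rw [if_pos (by simp [Real.sqrt_nonneg]), hXP, h2]
    · rintro ⟨z, hz, rfl⟩
      rw [sphere_iff] at hz
      have h3 : |z 0| ≤ 1 := by rw [← sq_le_one_iff_abs_le_one]; nlinarith [sq_nonneg (z 1)]
      rw [abs_le] at h3
      refine ⟨⟨?_, ?_⟩, ?_⟩
      · simp only [hX]; nlinarith
      · simp only [hX]; nlinarith
      · simp only
        split_ifs
        · exact Or.inr rfl
        · exact Or.inl rfl

theorem exists_curve (Y : Finset Pt) (hinj : InjOn Prod.fst (Y : Set Pt)) (hY : 2 ≤ Y.card)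
    (c : Pt → ℕ) (hc : ∀ p ∈ Y, ∀ q ∈ Y, p.1 ≤ q.1 → c p ≤ c q)
    (hi : ∀ i, (∀ p ∈ Y, ∀ q ∈ Y, ∀ r ∈ Y, c p = i → c q = i → c r = i → p.1 < q.1 → q.1 < r.1 → 0 ≤ ori p q r) ∨
      (∀ p ∈ Y, ∀ q ∈ Y, ∀ r ∈ Y, c p = i → c q = i → c r = i → p.1 < q.1 → q.1 < r.1 → ori p q r ≤ 0))
    (τ : ℝ) (hτ : ∀ p ∈ Y, ∀ q ∈ Y, ∀ r ∈ Y, c p < c q → c q < c r → 0 < τ * ori p q r)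
    (hτ0 : τ ≠ 0) (d : ℕ) (hd : 14 ≤ d) :
    ∃ J, IsJordanCurve J ∧ StabLE J d ∧ (↑Y : Set Pt) ⊆ J := by
  have hne : Y.Nonempty := Finset.card_pos.1 (by omega)
  obtain ⟨g, M, hM, hlip, hg⟩ := exists_interp Y hinj hne
  obtain ⟨a, ha, ham⟩ := Y.exists_min_image (fun r => r.1) hne
  obtain ⟨b, hb, hbm⟩ := Y.exists_max_image (fun r => r.1) hne
  have hab : a.1 < b.1 := by
    obtain ⟨p, hp, q, hq, hpq⟩ := Finset.one_lt_card.1 (by omega : 1 < Y.card)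
    by_contra hcon
    apply hpq
    apply hinj hp hq
    linarith [ham p hp, ham q hq, hbm p hp, hbm q hq]
  have hgc : Continuous g := by
    have : LipschitzWith ⟨M, hM⟩ g := LipschitzWith.of_dist_le_mul (fun x y => by
      rw [Real.dist_eq, Real.dist_eq]; exact hlip x y)
    exact this.continuous
  set h : ℝ → ℝ := fun x => min (g a.1 + (M + 1) * (x - a.1)) (g b.1 + (M + 1) * (b.1 - x)) with hh
  have hhc : Continuous h := by simp only [hh]; fun_prop
  have hlab := abs_le.1 (hlip a.1 b.1)
  rw [abs_of_neg (by linarith : a.1 - b.1 < 0)] at hlab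
  have e0 : h a.1 = g a.1 := by
    simp only [hh]
    rw [min_eq_left] <;> nlinarith
  have e1 : h b.1 = g b.1 := by
    simp only [hh]
    rw [min_eq_right] <;> nlinarith
  have hlt : ∀ x, a.1 < x → x < b.1 → g x < h x := by
    intro x h1 h2
    simp only [hh]
    have l1 := abs_le.1 (hlip x a.1)
    have l2 := abs_le.1 (hlip x b.1)
    rw [abs_of_pos (by linarith : 0 < x - a.1)] at l1
    rw [abs_of_neg (by linarith : x - b.1 < 0)] at l2
    apply lt_min <;> nlinarith
  refine ⟨_, jordan_two_graphs a.1 b.1 hab g h hgc hhc e0 e1 hlt, ?_, ?_⟩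
  · rintro l ⟨α, β, γ, hαβ, rfl⟩
    apply compsLE_of_cov
    by_cases hβ : β = 0
    · have hα : α ≠ 0 := by tauto
      refine cov_mono (m := 1 + 1) ?_ (by omega : 1 + 1 ≤ d)
      have e : {P : Pt | P.1 ∈ Icc a.1 b.1 ∧ (P.2 = g P.1 ∨ P.2 = h P.1)} ∩ {p : Pt | α * p.1 + β * p.2 = γ} =
          {P : Pt | P.1 ∈ Icc a.1 b.1 ∧ P.2 = g P.1 ∧ α * P.1 = γ} ∪
          {P : Pt | P.1 ∈ Icc a.1 b.1 ∧ P.2 = h P.1 ∧ α * P.1 = γ} := by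
        ext P
        simp only [mem_inter_iff, mem_union, mem_ofPred_eq, hβ, zero_mul, add_zero]
        tauto
      rw [e]
      refine cov_union (cov_one ?_) (cov_one ?_)
      · apply Set.Subsingleton.isPreconnected
        rintro P ⟨_, h1, h2⟩ Q ⟨_, h3, h4⟩
        have : P.1 = Q.1 := mul_left_cancel₀ hα (h2.trans h4.symm)
        apply Prod.ext this
        rw [h1, h3, this]
      · apply Set.Subsingleton.isPreconnected
        rintro P ⟨_, h1, h2⟩ Q ⟨_, h3, h4⟩
        have : P.1 = Q.1 := mul_left_cancel₀ hα (h2.trans h4.symm)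
        apply Prod.ext this
        rw [h1, h3, this]
    · refine cov_mono (m := 12 + 2) ?_ (by omega : 12 + 2 ≤ d)
      set u := -α / β with hu
      set v := γ / β with hv
      have hline : ∀ P : Pt, α * P.1 + β * P.2 = γ ↔ P.2 = u * P.1 + v := by
        intro P
        rw [hu, hv]
        field_simp
        constructor <;> intro h <;> linarith
      have e : {P : Pt | P.1 ∈ Icc a.1 b.1 ∧ (P.2 = g P.1 ∨ P.2 = h P.1)} ∩ {p : Pt | α * p.1 + β * p.2 = γ} =
          (fun x => ((x, u * x + v) : Pt)) '' ({x | x ∈ Icc a.1 b.1 ∧ g x = u * x + v} ∪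
            {x | x ∈ Icc a.1 b.1 ∧ h x = u * x + v}) := by
        ext P
        constructor
        · rintro ⟨⟨h1, h2⟩, h3⟩
          have h3' := (hline P).1 h3
          refine ⟨P.1, ?_, ?_⟩
          · rcases h2 with h2 | h2
            · exact Or.inl ⟨h1, by rw [← h2, h3']⟩
            · exact Or.inr ⟨h1, by rw [← h2, h3']⟩
          · exact Prod.ext rfl h3'.symm
        · rintro ⟨x, hx, rfl⟩
          rcases hx with ⟨h1, h2⟩ | ⟨h1, h2⟩
          · exact ⟨⟨h1, Or.inl h2.symm⟩, (hline _).2 rfl⟩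
          · exact ⟨⟨h1, Or.inr h2.symm⟩, (hline _).2 rfl⟩
      rw [e]
      apply cov_image _ _ (by fun_prop)
      refine cov_union (cov_graph Y hinj g hg u v c hc hi τ hτ hτ0 a b ha hb hab ham hbm) ?_
      have hs : Supp a.1 b.1 (fun x => u * x + v - h x) := by
        intro x hx
        simp only [hh]
        rcases le_total (g a.1 + (M + 1) * (x - a.1)) (g b.1 + (M + 1) * (b.1 - x)) with hle | hle
        · refine ⟨u - (M + 1), fun y hy => ?_⟩
          rw [min_eq_left hle]
          have := min_le_left (g a.1 + (M + 1) * (y - a.1)) (g b.1 + (M + 1) * (b.1 - y))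
          linarith
        · refine ⟨u + (M + 1), fun y hy => ?_⟩
          rw [min_eq_right hle]
          have := min_le_right (g a.1 + (M + 1) * (y - a.1)) (g b.1 + (M + 1) * (b.1 - y))
          linarith
      have := cov_supp hs
      convert this using 4
      rw [sub_eq_zero, eq_comm]
  · intro p hp
    exact ⟨⟨ham p hp, hbm p hp⟩, Or.inl (hg.1 p hp).symm⟩

/-- All increasing triples below `R`. -/
def trip (R : ℕ) : Finset (ℕ × ℕ × ℕ) :=
  (Finset.range R ×ˢ Finset.range R ×ˢ Finset.range R).filter (fun t => t.1 < t.2.1 ∧ t.2.1 < t.2.2)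

theorem exists_good (N K m : ℕ) (p : Fin N → Pt) (hp : StrictMono (fun a => (p a).1))
    (hgp : ∀ a b c, a ≠ b → a ≠ c → b ≠ c → ori (p a) (p b) (p c) ≠ 0)
    (hN : 2 ^ (K + K) * (4 ^ (trip (2 ^ (K + K))).card * 4 ^ m) ≤ N) :
    ∃ (S : Finset (Fin N)) (c : Fin N → ℕ) (τ : ℝ), S.card = K * m ∧ Monotone c ∧ τ ≠ 0 ∧
      (∀ a ∈ S, ∀ b ∈ S, ∀ d ∈ S, c a < c b → c b < c d → 0 < τ * ori (p a) (p b) (p d)) ∧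
      (∀ i, (∀ a ∈ S, ∀ b ∈ S, ∀ d ∈ S, c a = i → c b = i → c d = i → a < b → b < d →
          0 ≤ ori (p a) (p b) (p d)) ∨
        (∀ a ∈ S, ∀ b ∈ S, ∀ d ∈ S, c a = i → c b = i → c d = i → a < b → b < d →
          ori (p a) (p b) (p d) ≤ 0)) := by
  classical
  set R := 2 ^ (K + K) with hR
  set s := 4 ^ (trip R).card * 4 ^ m with hs
  have hspos : 0 < s := by positivity
  set c : Fin N → ℕ := fun a => a.val / s with hc
  have hcm : Monotone c := fun a b hab => Nat.div_le_div_right hab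
  have hclt : ∀ a b, c a < c b → a < b := by
    intro a b h
    by_contra hcon
    exact absurd (hcm (not_lt.1 hcon)) (not_le.2 h)
  set A : ℕ → Finset (Fin N) := fun i => Finset.univ.filter (fun a => c a = i) with hA
  have hAcard : ∀ i, i < R → s ≤ (A i).card := by
    intro i hi
    have hsub : Finset.Ico (i * s) (i * s + s) ⊆ (A i).image (fun a => a.val) := by
      intro x hx
      rw [Finset.mem_Ico] at hx
      have hxN : x < N := by
        have : (i + 1) * s ≤ R * s := Nat.mul_le_mul_right s hi
        have e : (i + 1) * s = i * s + s := by ring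
        omega
      rw [Finset.mem_image]
      refine ⟨⟨x, hxN⟩, ?_, rfl⟩
      simp only [hA, hc, Finset.mem_filter, Finset.mem_univ, true_and]
      rw [Nat.div_eq_iff hspos]
      constructor
      · exact hx.1
      · have := hx.2
        omega
    have := (Finset.card_le_card hsub).trans Finset.card_image_le
    simpa using this
  obtain ⟨A', hA', hA'c, hhom⟩ := sameType p hp hgp R (trip R)
    (by
      intro t ht
      simp only [trip, Finset.mem_filter, Finset.mem_product, Finset.mem_range] at ht
      exact ⟨ht.2.1, ht.2.2, ht.1.2.2⟩)
    A (by
      intro i j hij hj a ha b hb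
      simp only [hA, Finset.mem_filter, Finset.mem_univ, true_and] at ha hb
      apply hclt
      omega) (4 ^ m) (by positivity) hAcard
  have hcA : ∀ i, ∀ a ∈ A' i, c a = i := by
    intro i a ha
    have := hA' i ha
    simpa [hA] using this
  have hrep : ∀ i : Fin R, ∃ a, a ∈ A' i := by
    intro i
    have h1 := hA'c i i.2
    have h2 : 0 < 4 ^ m := by positivity
    exact Finset.card_pos.1 (lt_of_lt_of_le h2 h1)
  choose rep hrep using hrep
  have hrepm : StrictMono rep := by
    intro i j hij
    apply hclt
    rw [hcA _ _ (hrep i), hcA _ _ (hrep j)]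
    exact hij
  have hclus : ∀ i : Fin R, ∃ B ⊆ A' i, B.card = m ∧
      (IsC (fun a b c => 0 < ori (p a) (p b) (p c)) B ∨ IsC (fun a b c => ¬ 0 < ori (p a) (p b) (p c)) B) := by
    intro i
    rcases es _ (trans3_pos p hp) (trans3_neg p hp) m m (A' i)
      (by have := hA'c i i.2; rw [← two_mul, pow_mul]; exact this) with ⟨B, h1, h2, h3⟩ | ⟨B, h1, h2, h3⟩
    · exact ⟨B, h1, h2, Or.inl h3⟩
    · exact ⟨B, h1, h2, Or.inr h3⟩
  choose B hBA hBc hB using hclus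
  have hreps : ∃ I : Finset (Fin R), I.card = K ∧ ∃ τ : ℝ, τ ≠ 0 ∧ ∀ i ∈ I, ∀ j ∈ I, ∀ k ∈ I, i < j → j < k →
      ∀ a ∈ A' i, ∀ b ∈ A' j, ∀ d ∈ A' k, 0 < τ * ori (p a) (p b) (p d) := by
    have hq : StrictMono (fun i => ((p ∘ rep) i).1) := fun i j hij => hp (hrepm hij)
    have hh : ∀ i j k : Fin R, i < j → j < k → Homog p A' i j k := by
      intro i j k hij hjk
      refine hhom (i.val, j.val, k.val) ?_
      simp only [trip, Finset.mem_filter, Finset.mem_product, Finset.mem_range]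
      exact ⟨⟨i.2, j.2, k.2⟩, hij, hjk⟩
    rcases es _ (trans3_pos (p ∘ rep) hq) (trans3_neg (p ∘ rep) hq) K K Finset.univ
      (by simp [hR]) with ⟨I, _, h2, h3⟩ | ⟨I, _, h2, h3⟩
    · refine ⟨I, h2, 1, one_ne_zero, ?_⟩
      intro i hi j hj k hk hij hjk a ha b hb d hd
      rw [one_mul]
      rcases hh i j k hij hjk with h | h
      · exact h a ha b hb d hd
      · exfalso
        have e1 := h3 i hi j hj k hk hij hjk
        have e2 := h _ (hrep i) _ (hrep j) _ (hrep k)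
        exact absurd e1 e2.asymm
    · refine ⟨I, h2, -1, by norm_num, ?_⟩
      intro i hi j hj k hk hij hjk a ha b hb d hd
      rcases hh i j k hij hjk with h | h
      · exfalso
        have e1 := h3 i hi j hj k hk hij hjk
        have e2 := h _ (hrep i) _ (hrep j) _ (hrep k)
        exact e1 e2
      · have := h a ha b hb d hd
        linarith
  obtain ⟨I, hIc, τ, hτ, hI⟩ := hreps
  have hcB : ∀ i : Fin R, ∀ a ∈ B i, c a = i := fun i a ha => hcA _ _ (hBA i ha)
  refine ⟨I.biUnion B, c, τ, ?_, hcm, hτ, ?_, ?_⟩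
  · rw [Finset.card_biUnion, Finset.sum_congr rfl (fun i _ => hBc i)]
    · simp [hIc]
    · intro i _ j _ hij
      change Disjoint (B i) (B j)
      rw [Finset.disjoint_left]
      intro a ha hb
      apply hij
      apply Fin.ext
      rw [← hcB i a ha, ← hcB j a hb]
  · intro a ha b hb d hd hab hbd
    rw [Finset.mem_biUnion] at ha hb hd
    obtain ⟨i, hi, ha⟩ := ha
    obtain ⟨j, hj, hb⟩ := hb
    obtain ⟨k, hk, hd⟩ := hd
    rw [hcB i a ha, hcB j b hb] at hab
    rw [hcB j b hb, hcB k d hd] at hbd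
    exact hI i hi j hj k hk hab hbd a (hBA i ha) b (hBA j hb) d (hBA k hd)
  · intro i
    have hin : ∀ a ∈ I.biUnion B, c a = i → ∀ h : i < R, a ∈ B ⟨i, h⟩ := by
      intro a ha hai h
      rw [Finset.mem_biUnion] at ha
      obtain ⟨j, hj, ha⟩ := ha
      have e : j = ⟨i, h⟩ := Fin.ext (by rw [← hcB j a ha, hai])
      rw [← e]; exact ha
    by_cases hiR : i < R
    · rcases hB ⟨i, hiR⟩ with h | h
      · left
        intro a ha b hb d hd e1 e2 e3 hab hbd
        exact (h a (hin a ha e1 hiR) b (hin b hb e2 hiR) d (hin d hd e3 hiR) hab hbd).le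
      · right
        intro a ha b hb d hd e1 e2 e3 hab hbd
        exact not_lt.1 (h a (hin a ha e1 hiR) b (hin b hb e2 hiR) d (hin d hd e3 hiR) hab hbd)
    · left
      intro a ha b hb d hd e1
      exfalso
      rw [Finset.mem_biUnion] at ha
      obtain ⟨j, hj, ha⟩ := ha
      have := hcB j a ha
      have := j.2
      omega

theorem fiber_le_two (X : Finset Pt) (hX : GenPos ↑X) : X.card ≤ 2 * (X.image Prod.fst).card := by
  classical
  apply Finset.card_le_mul_card_image
  intro v _
  by_contra hcon
  obtain ⟨a, ha, b, hb, d, hd, hab, had, hbd⟩ := Finset.two_lt_card.1 (not_le.1 hcon)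
  rw [Finset.mem_filter] at ha hb hd
  apply ori_ne_zero hX (Finset.mem_coe.2 ha.1) (Finset.mem_coe.2 hb.1) (Finset.mem_coe.2 hd.1) hab had hbd
  unfold ori
  rw [ha.2, hb.2, hd.2]
  ring

theorem main_count (K m n d : ℕ) (hn : 2 ≤ n) (hKm : n ≤ K * m) (hd : 14 ≤ d) (X : Finset Pt) (hX : GenPos ↑X)
    (hcard : 2 * (2 ^ (K + K) * (4 ^ (trip (2 ^ (K + K))).card * 4 ^ m)) ≤ X.card) :
    ∃ Y ⊆ X, Y.card = n ∧ ∃ J, IsJordanCurve J ∧ StabLE J d ∧ (↑Y : Set Pt) ⊆ J := by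
  classical
  set V := X.image Prod.fst with hV
  have hVc : X.card ≤ 2 * V.card := fiber_le_two X hX
  have hex : ∀ a : Fin V.card, ∃ P ∈ X, P.1 = V.orderEmbOfFin rfl a := by
    intro a
    have := V.orderEmbOfFin_mem rfl a
    exact Finset.mem_image.1 this
  choose p hpX hpe using hex
  have hp : StrictMono (fun a => (p a).1) := by
    intro a b hab
    simp only [hpe]
    exact (V.orderEmbOfFin rfl).strictMono hab
  have hpinj : Function.Injective p := fun a b h => hp.injective (by simp only [h])
  obtain ⟨S, c, τ, hSc, hcm, hτ0, htr, hcl⟩ := exists_good V.card K m p hp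
    (fun a b c hab hac hbc => ori_ne_zero hX (Finset.mem_coe.2 (hpX a)) (Finset.mem_coe.2 (hpX b)) (Finset.mem_coe.2 (hpX c))
      (fun h => hab (hpinj h)) (fun h => hac (hpinj h)) (fun h => hbc (hpinj h))) (by omega)
  obtain ⟨S', hS', hS'c⟩ := Finset.exists_subset_card_eq (hKm.trans hSc.ge)
  have hcard' : (S'.image p).card = n := by rw [Finset.card_image_of_injective _ hpinj, hS'c]
  refine ⟨S'.image p, ?_, hcard', ?_⟩
  · intro P hP
    obtain ⟨a, _, rfl⟩ := Finset.mem_image.1 hP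
    exact hpX a
  · have hce : ∀ a, Function.extend p c 0 (p a) = c a := fun a => hpinj.extend_apply c 0 a
    have hall : ∀ {Q : Pt → Prop}, (∀ a ∈ S', Q (p a)) → ∀ P ∈ S'.image p, Q P := by
      intro Q h P hP
      obtain ⟨a, ha, rfl⟩ := Finset.mem_image.1 hP
      exact h a ha
    refine exists_curve (S'.image p) ?_ (by omega) (Function.extend p c 0) ?_ ?_ τ ?_ hτ0 d hd
    · intro P hP Q hQ h
      obtain ⟨a, _, rfl⟩ := Finset.mem_image.1 (Finset.mem_coe.1 hP)
      obtain ⟨b, _, rfl⟩ := Finset.mem_image.1 (Finset.mem_coe.1 hQ)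
      exact congrArg p (hp.injective h)
    · refine hall fun a ha => hall fun b hb => ?_
      intro h
      rw [hce, hce]
      exact hcm (hp.le_iff_le.1 h)
    · intro i
      rcases hcl i with h | h
      · left
        refine hall fun a ha => hall fun b hb => hall fun d hd => ?_
        rw [hce, hce, hce]
        intro e1 e2 e3 h1 h2
        exact h a (hS' ha) b (hS' hb) d (hS' hd) e1 e2 e3 (hp.lt_iff_lt.1 h1) (hp.lt_iff_lt.1 h2)
      · right
        refine hall fun a ha => hall fun b hb => hall fun d hd => ?_
        rw [hce, hce, hce]
        intro e1 e2 e3 h1 h2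
        exact h a (hS' ha) b (hS' hb) d (hS' hd) e1 e2 e3 (hp.lt_iff_lt.1 h1) (hp.lt_iff_lt.1 h2)
    · refine hall fun a ha => hall fun b hb => hall fun d hd => ?_
      rw [hce, hce, hce]
      exact htr a (hS' ha) b (hS' hb) d (hS' hd)

/-- Theorem 5.3. -/
theorem stmt_13 : ∃ C : ℝ, 0 < C ∧ ∃ D : ℕ, ∀ d : ℕ, D ≤ d → ∀ ε : ℝ, 0 < ε →
    ∃ n₀ : ℕ, ∀ n : ℕ, n₀ ≤ n → ∀ X : Finset Pt, GenPos ↑X →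
      (2 : ℝ) ^ ((1 + C / Real.sqrt d) * n / d + ε * n) ≤ (X.card : ℝ) →
      ∃ Y ⊆ X, Y.card = n ∧
        ∃ J, IsJordanCurve J ∧ StabLE J d ∧ (↑Y : Set Pt) ⊆ J := by
  refine ⟨1, one_pos, 14, ?_⟩
  intro d hd ε hε
  obtain ⟨K, hK⟩ := exists_nat_gt (4 / ε)
  have hKpos : (0 : ℝ) < K := lt_trans (by positivity) hK
  have hKε : 4 < K * ε := by rwa [div_lt_iff₀ hε] at hK
  have hKn : 0 < K := by exact_mod_cast hKpos
  set q := 2 ^ (K + K) * 4 ^ (trip (2 ^ (K + K))).card with hq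
  obtain ⟨n1, hn1⟩ := exists_nat_gt (2 * (8 * q : ℕ) / ε)
  refine ⟨max 2 n1, ?_⟩
  intro n hn X hX hXc
  have hn2 : 2 ≤ n := (le_max_left _ _).trans hn
  have hnn1 : n1 ≤ n := (le_max_right _ _).trans hn
  have hbig : 2 * ((8 * q : ℕ) : ℝ) ≤ ε * n := by
    have : 2 * ((8 * q : ℕ) : ℝ) / ε < n := hn1.trans_le (by exact_mod_cast hnn1)
    rw [div_lt_iff₀ hε] at this
    linarith
  refine main_count K (n / K + 1) n d hn2 ?_ hd X hX ?_
  · have h1 := Nat.div_add_mod n K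
    have h2 := Nat.mod_lt n hKn
    rw [mul_add, mul_one]
    omega
  · have hdiv : ((n / K : ℕ) : ℝ) ≤ ε * n / 4 := by
      refine Nat.cast_div_le.trans ?_
      rw [div_le_div_iff₀ hKpos (by norm_num)]
      have : (0 : ℝ) ≤ n := Nat.cast_nonneg n
      nlinarith
    have hle : 2 * (2 ^ (K + K) * (4 ^ (trip (2 ^ (K + K))).card * 4 ^ (n / K + 1))) ≤ 2 ^ (8 * q + 2 * (n / K)) := by
      have e : 2 * (2 ^ (K + K) * (4 ^ (trip (2 ^ (K + K))).card * 4 ^ (n / K + 1))) = 8 * q * 2 ^ (2 * (n / K)) := by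
        rw [hq, pow_succ, pow_mul]; norm_num; ring
      rw [e, pow_add]
      exact Nat.mul_le_mul_right _ (Nat.lt_two_pow_self).le
    refine hle.trans ?_
    have hfin : ((2 ^ (8 * q + 2 * (n / K)) : ℕ) : ℝ) ≤ X.card := by
      refine le_trans ?_ hXc
      push_cast
      rw [← Real.rpow_natCast]
      apply Real.rpow_le_rpow_of_exponent_le (by norm_num)
      have hpos : 0 ≤ (1 + 1 / Real.sqrt d) * n / d := by positivity
      push_cast at hbig ⊢
      push_cast at hdiv
      linarith
    exact_mod_cast hfin
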